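/- arXiv:2303.00115 — 3 statements merged into one kernel-verified Lean document; each statement's English description precedes it below -/
import Mathlib

section
/- Let r ≥ 2 and let f : ℝ → ℝ be a C^r map with f(0) = 0 and f'(0) = λ, where λ ∉ {-1, 0, 1}. Then there exist open neighbourhoods U of 0 and V of 0 and a C^r diffeomorphism h : U → V with h(0) = 0 such that h(f(x)) = λ·h(x) for every x ∈ U with f(x) ∈ U. -/
open Metric Filter Topology

/-- The `n`-th iterate of the weighted composition operator `u ↦ m * (u ∘ f)`, applied to `a`. -/
def weightedIterate (m f a : ℝ → ℝ) : ℕ → ℝ → ℝ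
  | 0 => a
  | n + 1 => fun x => m x * weightedIterate m f a n (f x)

section WeightedComposition

variable {f m a N : ℝ → ℝ} {c δ : ℝ}

theorem norm_weightedIterate_le (hc : 0 ≤ c) (hm : ∀ x ∈ ball (0 : ℝ) δ, ‖m x‖ ≤ c)
    (hf : ∀ x ∈ ball (0 : ℝ) δ, ‖f x‖ ≤ ‖x‖) {s A : ℝ} (hs : s < δ)
    (ha : ∀ x, ‖x‖ ≤ s → ‖a x‖ ≤ A) (n : ℕ) :
    ∀ x, ‖x‖ ≤ s → ‖weightedIterate m f a n x‖ ≤ A * c ^ n := by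
  induction n with
  | zero => simpa [weightedIterate] using ha
  | succ n ih =>
    intro x hx
    have hxδ : x ∈ ball (0 : ℝ) δ := mem_ball_zero_iff.2 (hx.trans_lt hs)
    calc ‖weightedIterate m f a (n + 1) x‖
        = ‖m x‖ * ‖weightedIterate m f a n (f x)‖ := norm_mul _ _
      _ ≤ c * (A * c ^ n) := by
          gcongr
          · exact hm x hxδ
          · exact ih _ ((hf x hxδ).trans hx)
      _ = A * c ^ (n + 1) := by ring

theorem exists_bound_of_continuousOn_ball (ha : ContinuousOn a (ball 0 δ)) {s : ℝ} (hs : s < δ) :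
    ∃ A, ∀ x, ‖x‖ ≤ s → ‖a x‖ ≤ A := by
  obtain ⟨A, hA⟩ := (isCompact_closedBall (0 : ℝ) s).exists_bound_of_continuousOn
    (ha.mono (closedBall_subset_ball hs))
  exact ⟨A, fun x hx => hA x (mem_closedBall_zero_iff.2 hx)⟩

theorem summable_weightedIterate (hc : 0 ≤ c) (hc1 : c < 1)
    (hm : ∀ x ∈ ball (0 : ℝ) δ, ‖m x‖ ≤ c) (hf : ∀ x ∈ ball (0 : ℝ) δ, ‖f x‖ ≤ ‖x‖)
    (ha : ContinuousOn a (ball 0 δ)) {x : ℝ} (hx : x ∈ ball (0 : ℝ) δ) :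
    Summable fun n => weightedIterate m f a n x := by
  have hs : ‖x‖ < δ := mem_ball_zero_iff.1 hx
  obtain ⟨A, hA⟩ := exists_bound_of_continuousOn_ball ha hs
  exact .of_norm_bounded ((summable_geometric_of_lt_one hc hc1).mul_left A)
    fun n => norm_weightedIterate_le hc hm hf hs hA n x le_rfl

/-- Existence of a locally bounded solution of `N = a + m * (N ∘ f)`. -/
theorem exists_solution_weighted (hc : 0 ≤ c) (hc1 : c < 1)
    (hm : ∀ x ∈ ball (0 : ℝ) δ, ‖m x‖ ≤ c) (hf : ∀ x ∈ ball (0 : ℝ) δ, ‖f x‖ ≤ ‖x‖)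
    (ha : ContinuousOn a (ball 0 δ)) :
    ∃ N : ℝ → ℝ, (∀ x ∈ ball (0 : ℝ) δ, N x = a x + m x * N (f x)) ∧
      ∀ s < δ, ∃ B, ∀ x, ‖x‖ ≤ s → ‖N x‖ ≤ B := by
  refine ⟨fun x => ∑' n, weightedIterate m f a n x, fun x hx => ?_, fun s hs => ?_⟩
  · simp only
    rw [(summable_weightedIterate hc hc1 hm hf ha hx).tsum_eq_zero_add, ← tsum_mul_left]
    rfl
  · obtain ⟨A, hA⟩ := exists_bound_of_continuousOn_ball ha hs
    exact ⟨_, fun x hx => tsum_of_norm_bounded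
      ((summable_geometric_of_lt_one hc hc1).mul_left A).hasSum
      fun n => norm_weightedIterate_le hc hm hf hs hA n x hx⟩

/-- A locally bounded solution of `N = a + m * (N ∘ f)` is the sum of its Neumann series. -/
theorem eq_tsum_weightedIterate (hc : 0 ≤ c) (hc1 : c < 1)
    (hm : ∀ x ∈ ball (0 : ℝ) δ, ‖m x‖ ≤ c) (hf : ∀ x ∈ ball (0 : ℝ) δ, ‖f x‖ ≤ ‖x‖)
    (ha : ContinuousOn a (ball 0 δ))
    (hN : ∀ x ∈ ball (0 : ℝ) δ, N x = a x + m x * N (f x))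
    (hNb : ∀ s < δ, ∃ B, ∀ x, ‖x‖ ≤ s → ‖N x‖ ≤ B) {x : ℝ} (hx : x ∈ ball (0 : ℝ) δ) :
    N x = ∑' n, weightedIterate m f a n x := by
  have step : ∀ n, ∀ y ∈ ball (0 : ℝ) δ, weightedIterate m f a n y =
      weightedIterate m f N n y - weightedIterate m f N (n + 1) y := by
    intro n
    induction n with
    | zero =>
      intro y hy
      simp only [weightedIterate]
      linarith [hN y hy]
    | succ n ih =>
      intro y hy
      have hfy : f y ∈ ball (0 : ℝ) δ :=
        mem_ball_zero_iff.2 ((hf y hy).trans_lt (mem_ball_zero_iff.1 hy))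
      have := ih _ hfy
      simp only [weightedIterate] at this ⊢
      rw [this]
      ring
  have hs : ‖x‖ < δ := mem_ball_zero_iff.1 hx
  obtain ⟨B, hB⟩ := hNb _ hs
  have hlim : Tendsto (fun n => weightedIterate m f N n x) atTop (𝓝 0) := by
    refine squeeze_zero_norm (fun n => norm_weightedIterate_le hc hm hf hs hB n x le_rfl) ?_
    simpa using (tendsto_pow_atTop_nhds_zero_of_lt_one hc hc1).const_mul B
  have hsum := (summable_weightedIterate hc hc1 hm hf ha hx).hasSum.tendsto_sum_nat
  refine tendsto_nhds_unique ?_ hsum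
  simp_rw [fun n => step n x hx, Finset.sum_range_sub']
  simpa [weightedIterate] using hlim.const_sub (N x)

theorem continuousOn_weightedIterate (hm : ContinuousOn m (ball 0 δ))
    (hfc : ContinuousOn f (ball 0 δ)) (hf : ∀ x ∈ ball (0 : ℝ) δ, ‖f x‖ ≤ ‖x‖)
    (ha : ContinuousOn a (ball 0 δ)) (n : ℕ) :
    ContinuousOn (weightedIterate m f a n) (ball 0 δ) := by
  induction n with
  | zero => exact ha
  | succ n ih =>
    exact hm.mul (ih.comp hfc fun x hx =>
      mem_ball_zero_iff.2 ((hf x hx).trans_lt (mem_ball_zero_iff.1 hx)))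

theorem continuousOn_of_solution_weighted (hc : 0 ≤ c) (hc1 : c < 1)
    (hm : ∀ x ∈ ball (0 : ℝ) δ, ‖m x‖ ≤ c) (hf : ∀ x ∈ ball (0 : ℝ) δ, ‖f x‖ ≤ ‖x‖)
    (hmc : ContinuousOn m (ball 0 δ)) (hfc : ContinuousOn f (ball 0 δ))
    (ha : ContinuousOn a (ball 0 δ))
    (hN : ∀ x ∈ ball (0 : ℝ) δ, N x = a x + m x * N (f x))
    (hNb : ∀ s < δ, ∃ B, ∀ x, ‖x‖ ≤ s → ‖N x‖ ≤ B) :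
    ContinuousOn N (ball 0 δ) := by
  refine ContinuousOn.congr (f := fun x => ∑' n, weightedIterate m f a n x) ?_
    fun x hx => eq_tsum_weightedIterate hc hc1 hm hf ha hN hNb hx
  intro x hx
  obtain ⟨s, hxs, hs⟩ := exists_between (mem_ball_zero_iff.1 hx)
  obtain ⟨A, hA⟩ := exists_bound_of_continuousOn_ball ha hs
  refine ContinuousAt.continuousWithinAt (ContinuousOn.continuousAt (s := ball 0 s) ?_
    (isOpen_ball.mem_nhds (mem_ball_zero_iff.2 hxs)))
  exact continuousOn_tsum
    (fun n => (continuousOn_weightedIterate hmc hfc hf ha n).mono (ball_subset_ball hs.le))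
    ((summable_geometric_of_lt_one hc hc1).mul_left A)
    fun n y hy => norm_weightedIterate_le hc hm hf hs hA n y (mem_ball_zero_iff.1 hy).le

theorem hasDerivAt_weightedIterate_succ (hf : ∀ x ∈ ball (0 : ℝ) δ, ‖f x‖ ≤ ‖x‖)
    (hmd : DifferentiableOn ℝ m (ball 0 δ)) (hfd : DifferentiableOn ℝ f (ball 0 δ)) {n : ℕ}
    (hu : DifferentiableOn ℝ (weightedIterate m f a n) (ball 0 δ)) {x : ℝ}
    (hx : x ∈ ball (0 : ℝ) δ) :
    HasDerivAt (weightedIterate m f a (n + 1))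
      (deriv m x * weightedIterate m f a n (f x) +
        m x * (deriv (weightedIterate m f a n) (f x) * deriv f x)) x := by
  have hfx : f x ∈ ball (0 : ℝ) δ :=
    mem_ball_zero_iff.2 ((hf x hx).trans_lt (mem_ball_zero_iff.1 hx))
  have h1 := (hmd.differentiableAt (isOpen_ball.mem_nhds hx)).hasDerivAt
  have h2 := (hfd.differentiableAt (isOpen_ball.mem_nhds hx)).hasDerivAt
  have h3 := (hu.differentiableAt (isOpen_ball.mem_nhds hfx)).hasDerivAt
  exact h1.mul (h3.comp x h2)

theorem differentiableOn_weightedIterate (hf : ∀ x ∈ ball (0 : ℝ) δ, ‖f x‖ ≤ ‖x‖)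
    (hmd : DifferentiableOn ℝ m (ball 0 δ)) (hfd : DifferentiableOn ℝ f (ball 0 δ))
    (had : DifferentiableOn ℝ a (ball 0 δ)) (n : ℕ) :
    DifferentiableOn ℝ (weightedIterate m f a n) (ball 0 δ) := by
  induction n with
  | zero => exact had
  | succ n ih =>
    exact fun x hx => (hasDerivAt_weightedIterate_succ hf hmd hfd ih hx).differentiableAt
      |>.differentiableWithinAt

theorem norm_deriv_weightedIterate_le (hc : 0 < c)
    (hm : ∀ x ∈ ball (0 : ℝ) δ, ‖m x‖ ≤ c) (hf : ∀ x ∈ ball (0 : ℝ) δ, ‖f x‖ ≤ ‖x‖)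
    (hf' : ∀ x ∈ ball (0 : ℝ) δ, ‖deriv f x‖ ≤ 1)
    (hmd : DifferentiableOn ℝ m (ball 0 δ)) (hfd : DifferentiableOn ℝ f (ball 0 δ))
    (had : DifferentiableOn ℝ a (ball 0 δ)) {s A B M : ℝ} (hs : s < δ)
    (hA : ∀ x, ‖x‖ ≤ s → ‖a x‖ ≤ A) (hB : ∀ x, ‖x‖ ≤ s → ‖deriv a x‖ ≤ B)
    (hM : ∀ x, ‖x‖ ≤ s → ‖deriv m x‖ ≤ M) (n : ℕ) :
    ∀ x, ‖x‖ ≤ s → ‖deriv (weightedIterate m f a n) x‖ ≤ (B + n * (M * A / c)) * c ^ n := by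
  induction n with
  | zero => simpa [weightedIterate] using hB
  | succ n ih =>
    intro x hx
    have hxδ : x ∈ ball (0 : ℝ) δ := mem_ball_zero_iff.2 (hx.trans_lt hs)
    have hfx : ‖f x‖ ≤ s := (hf x hxδ).trans hx
    have hM0 : 0 ≤ M := (norm_nonneg _).trans (hM x hx)
    have h0 := (norm_nonneg _).trans (ih _ hfx)
    rw [(hasDerivAt_weightedIterate_succ hf hmd hfd
      (differentiableOn_weightedIterate hf hmd hfd had n) hxδ).deriv]
    calc _ ≤ ‖deriv m x‖ * ‖weightedIterate m f a n (f x)‖ +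
          ‖m x‖ * (‖deriv (weightedIterate m f a n) (f x)‖ * ‖deriv f x‖) := by
          simpa only [norm_mul] using norm_add_le
            (deriv m x * weightedIterate m f a n (f x))
            (m x * (deriv (weightedIterate m f a n) (f x) * deriv f x))
      _ ≤ M * (A * c ^ n) + c * ((B + n * (M * A / c)) * c ^ n * 1) := by
          gcongr
          · exact hM x hx
          · exact norm_weightedIterate_le hc.le hm hf hs hA n _ hfx
          · exact hm x hxδ
          · exact ih _ hfx
          · exact hf' x hxδ
      _ = _ := by
          push_cast
          field_simp
          ring

theorem differentiableOn_of_solution_weighted (hc : 0 < c) (hc1 : c < 1)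
    (hm : ∀ x ∈ ball (0 : ℝ) δ, ‖m x‖ ≤ c) (hf : ∀ x ∈ ball (0 : ℝ) δ, ‖f x‖ ≤ ‖x‖)
    (hf' : ∀ x ∈ ball (0 : ℝ) δ, ‖deriv f x‖ ≤ 1)
    (hmd : DifferentiableOn ℝ m (ball 0 δ)) (hmc : ContinuousOn (deriv m) (ball 0 δ))
    (hfd : DifferentiableOn ℝ f (ball 0 δ))
    (had : DifferentiableOn ℝ a (ball 0 δ)) (hac : ContinuousOn (deriv a) (ball 0 δ))
    (hN : ∀ x ∈ ball (0 : ℝ) δ, N x = a x + m x * N (f x))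
    (hNb : ∀ s < δ, ∃ B, ∀ x, ‖x‖ ≤ s → ‖N x‖ ≤ B) :
    DifferentiableOn ℝ N (ball 0 δ) ∧ ∀ s < δ, ∃ B, ∀ x, ‖x‖ ≤ s → ‖deriv N x‖ ≤ B := by
  have key : ∀ s < δ, ∃ B, ∀ x ∈ ball (0 : ℝ) s, DifferentiableAt ℝ N x ∧ ‖deriv N x‖ ≤ B := by
    intro s hs
    obtain ⟨A, hA⟩ := exists_bound_of_continuousOn_ball had.continuousOn hs
    obtain ⟨B, hB⟩ := exists_bound_of_continuousOn_ball hac hs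
    obtain ⟨M, hM⟩ := exists_bound_of_continuousOn_ball hmc hs
    have hsum : Summable fun n : ℕ => (B + n * (M * A / c)) * c ^ n := by
      have h1 := (summable_geometric_of_lt_one hc.le hc1).mul_left B
      have h2 := (summable_pow_mul_geometric_of_norm_lt_one 1
        (show ‖c‖ < 1 by rwa [Real.norm_of_nonneg hc.le])).mul_left (M * A / c)
      refine (h1.add h2).congr fun n => ?_
      ring
    have hbound : ∀ n : ℕ, ∀ y ∈ ball (0 : ℝ) s, ‖deriv (weightedIterate m f a n) y‖ ≤
        (B + n * (M * A / c)) * c ^ n := fun n y hy =>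
      norm_deriv_weightedIterate_le hc hm hf hf' hmd hfd had hs hA hB hM n y
        (mem_ball_zero_iff.1 hy).le
    refine ⟨∑' n : ℕ, (B + n * (M * A / c)) * c ^ n, fun x hx => ?_⟩
    have hD : HasDerivAt N (∑' n, deriv (weightedIterate m f a n) x) x := by
      refine (hasDerivAt_tsum_of_isPreconnected hsum isOpen_ball
        (convex_ball (0 : ℝ) s).isPreconnected (fun n y hy =>
          ((differentiableOn_weightedIterate hf hmd hfd had n).differentiableAt
            (isOpen_ball.mem_nhds (ball_subset_ball hs.le hy))).hasDerivAt) hbound hx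
        (summable_weightedIterate hc.le hc1 hm hf had.continuousOn
          (ball_subset_ball hs.le hx)) hx).congr_of_eventuallyEq ?_
      filter_upwards [isOpen_ball.mem_nhds hx] with y hy
      exact eq_tsum_weightedIterate hc.le hc1 hm hf had.continuousOn hN hNb
        (ball_subset_ball hs.le hy)
    exact ⟨hD.differentiableAt, hD.deriv ▸ tsum_of_norm_bounded hsum.hasSum
      fun n => hbound n x hx⟩
  refine ⟨fun x hx => ?_, fun s hs => ?_⟩
  · obtain ⟨s, hxs, hs⟩ := exists_between (mem_ball_zero_iff.1 hx)
    obtain ⟨B, hB⟩ := key s hs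
    exact (hB x (mem_ball_zero_iff.2 hxs)).1.differentiableWithinAt
  · obtain ⟨t, hst, ht⟩ := exists_between hs
    obtain ⟨B, hB⟩ := key t ht
    exact ⟨B, fun x hx => (hB x (mem_ball_zero_iff.2 (hx.trans_lt hst))).2⟩

/-- Regularity of locally bounded solutions of `N = a + m * (N ∘ f)`, for a contracting
weight `m`. -/
theorem contDiffOn_of_solution_weighted (hc : 0 < c) (hc1 : c < 1)
    (hf : ∀ x ∈ ball (0 : ℝ) δ, ‖f x‖ ≤ ‖x‖) (hf' : ∀ x ∈ ball (0 : ℝ) δ, ‖deriv f x‖ ≤ 1)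
    (k : ℕ) (hfk : ContDiffOn ℝ k f (ball 0 δ))
    (hm : ∀ x ∈ ball (0 : ℝ) δ, ‖m x‖ ≤ c)
    (hmk : ContDiffOn ℝ k m (ball 0 δ)) (hak : ContDiffOn ℝ k a (ball 0 δ))
    (hN : ∀ x ∈ ball (0 : ℝ) δ, N x = a x + m x * N (f x))
    (hNb : ∀ s < δ, ∃ B, ∀ x, ‖x‖ ≤ s → ‖N x‖ ≤ B) :
    ContDiffOn ℝ k N (ball 0 δ) := by
  induction k generalizing a m N with
  | zero =>
    simp only [Nat.cast_zero, contDiffOn_zero] at *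
    exact continuousOn_of_solution_weighted hc.le hc1 hm hf hmk hfk hak hN hNb
  | succ k ih =>
    have hle : (k : WithTop ℕ∞) ≤ ((k + 1 : ℕ) : WithTop ℕ∞) := by
      exact_mod_cast Nat.le_succ k
    have hNk := ih (hfk.of_le hle) hm (hmk.of_le hle) (hak.of_le hle) hN hNb
    have hmaps : Set.MapsTo f (ball 0 δ) (ball 0 δ) := fun x hx =>
      mem_ball_zero_iff.2 ((hf x hx).trans_lt (mem_ball_zero_iff.1 hx))
    have hfk0 := hfk.of_le hle
    have hmk0 := hmk.of_le hle
    push_cast at hfk hmk hak ⊢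
    rw [contDiffOn_succ_iff_deriv_of_isOpen isOpen_ball] at hfk hmk hak ⊢
    obtain ⟨hfd, -, hfc⟩ := hfk
    obtain ⟨hmd, -, hmc⟩ := hmk
    obtain ⟨had, -, hac⟩ := hak
    obtain ⟨hNd, hNb'⟩ := differentiableOn_of_solution_weighted hc hc1 hm hf hf' hmd
      hmc.continuousOn hfd had hac.continuousOn hN hNb
    refine ⟨hNd, fun h => by simp at h, ?_⟩
    refine ih hfk0 (m := fun x => m x * deriv f x)
      (a := fun x => deriv a x + deriv m x * N (f x)) ?_ (hmk0.mul hfc)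
      (hac.add (hmc.mul (hNk.comp hfk0 hmaps))) ?_ hNb'
    · intro x hx
      calc ‖m x * deriv f x‖ = ‖m x‖ * ‖deriv f x‖ := norm_mul _ _
        _ ≤ c * 1 := by
          gcongr
          · exact hm x hx
          · exact hf' x hx
        _ = c := mul_one c
    · intro x hx
      have hnx := isOpen_ball.mem_nhds hx
      have h1 := (had.differentiableAt hnx).hasDerivAt
      have h2 := (hmd.differentiableAt hnx).hasDerivAt
      have h3 := (hfd.differentiableAt hnx).hasDerivAt
      have h4 := (hNd.differentiableAt (isOpen_ball.mem_nhds (hmaps hx))).hasDerivAt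
      have h5 := (h1.add (h2.mul (h4.comp x h3))).congr_of_eventuallyEq
        (f₁ := N) (by filter_upwards [hnx] with y hy using hN y hy)
      rw [h5.deriv]
      simp only [Function.comp_apply]
      ring

end WeightedComposition

theorem exists_primitive_contDiffOn_ball {N : ℝ → ℝ} {δ : ℝ} {k : ℕ}
    (hN : ContDiffOn ℝ k N (ball 0 δ)) :
    ∃ F : ℝ → ℝ, F 0 = 0 ∧ (∀ x ∈ ball (0 : ℝ) δ, HasDerivAt F (N x) x) ∧
      ContDiffOn ℝ (k + 1 : ℕ) F (ball 0 δ) := by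
  have hD : ∀ x ∈ ball (0 : ℝ) δ, HasDerivAt (fun u => ∫ t in (0 : ℝ)..u, N t) (N x) x := by
    intro x hx
    have h0 : (0 : ℝ) ∈ ball (0 : ℝ) δ :=
      mem_ball_self ((norm_nonneg x).trans_lt (mem_ball_zero_iff.1 hx))
    have hsub : Set.uIcc 0 x ⊆ ball (0 : ℝ) δ :=
      (convex_ball (0 : ℝ) δ).ordConnected.uIcc_subset h0 hx
    exact intervalIntegral.integral_hasDerivAt_right
      (hN.continuousOn.mono hsub).intervalIntegrable
      (hN.continuousOn.stronglyMeasurableAtFilter isOpen_ball x hx)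
      (hN.continuousOn.continuousAt (isOpen_ball.mem_nhds hx))
  refine ⟨_, intervalIntegral.integral_same, hD, ?_⟩
  push_cast
  rw [contDiffOn_succ_iff_deriv_of_isOpen isOpen_ball]
  exact ⟨fun x hx => (hD x hx).differentiableAt.differentiableWithinAt, fun h => by simp at h,
    hN.congr fun x hx => (hD x hx).deriv⟩

theorem eq_zero_value_of_hasDerivAt_zero_ball {G : ℝ → ℝ} {δ : ℝ}
    (hG : ∀ x ∈ ball (0 : ℝ) δ, HasDerivAt G 0 x) {x : ℝ} (hx : x ∈ ball (0 : ℝ) δ) :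
    G x = G 0 :=
  isOpen_ball.is_const_of_deriv_eq_zero (convex_ball (0 : ℝ) δ).isPreconnected
    (fun y hy => (hG y hy).differentiableAt.differentiableWithinAt)
    (fun y hy => (hG y hy).deriv) hx
    (mem_ball_self ((norm_nonneg x).trans_lt (mem_ball_zero_iff.1 hx)))

/-- The linearization of a contraction `f` on an interval: the nonlinearity `N = h'' / h'`
of the conjugacy solves `N = f'' / f' + f' * (N ∘ f)`. -/
theorem exists_linearization_on_ball {f : ℝ → ℝ} {c δ : ℝ} {k : ℕ} (hδ : 0 < δ) (hc : 0 < c)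
    (hc1 : c < 1) (hfk : ContDiffOn ℝ (k + 2 : ℕ) f (ball 0 δ)) (hf0 : f 0 = 0)
    (hf' : ∀ x ∈ ball (0 : ℝ) δ, ‖deriv f x‖ ≤ c) (hne : ∀ x ∈ ball (0 : ℝ) δ, deriv f x ≠ 0) :
    ∃ h : ℝ → ℝ, ContDiffOn ℝ (k + 2 : ℕ) h (ball 0 δ) ∧ h 0 = 0 ∧ deriv h 0 ≠ 0 ∧
      ∀ x ∈ ball (0 : ℝ) δ, h (f x) = deriv f 0 * h x := by
  have h0 : (0 : ℝ) ∈ ball (0 : ℝ) δ := mem_ball_self hδ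
  have hfk0 : ContDiffOn ℝ k f (ball 0 δ) := hfk.of_le (by exact_mod_cast Nat.le_add_right k 2)
  have hfk' : ContDiffOn ℝ ((k + 1 : ℕ) + 1) f (ball 0 δ) := by exact_mod_cast hfk
  obtain ⟨hfd, -, hf1⟩ := (contDiffOn_succ_iff_deriv_of_isOpen isOpen_ball).1 hfk'
  have hf1' : ContDiffOn ℝ (k + 1) (deriv f) (ball 0 δ) := by exact_mod_cast hf1
  obtain ⟨hf1d, -, hf2⟩ := (contDiffOn_succ_iff_deriv_of_isOpen isOpen_ball).1 hf1'
  have hf1k : ContDiffOn ℝ k (deriv f) (ball 0 δ) :=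
    hf1.of_le (by exact_mod_cast Nat.le_succ k)
  have hfx : ∀ x ∈ ball (0 : ℝ) δ, ‖f x‖ ≤ ‖x‖ := by
    intro x hx
    have := (convex_ball (0 : ℝ) δ).norm_image_sub_le_of_norm_deriv_le
      (fun y hy => hfd.differentiableAt (isOpen_ball.mem_nhds hy)) hf' h0 hx
    rw [hf0, sub_zero, sub_zero] at this
    nlinarith [norm_nonneg x]
  have hmaps : Set.MapsTo f (ball 0 δ) (ball 0 δ) := fun x hx =>
    mem_ball_zero_iff.2 ((hfx x hx).trans_lt (mem_ball_zero_iff.1 hx))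
  have hak : ContDiffOn ℝ k (fun x => deriv (deriv f) x / deriv f x) (ball 0 δ) :=
    hf2.div hf1k hne
  obtain ⟨N, hN, hNb⟩ := exists_solution_weighted hc.le hc1 hf' hfx hak.continuousOn
  have hNk := contDiffOn_of_solution_weighted hc hc1 hfx (fun x hx => (hf' x hx).trans hc1.le) k
    hfk0 hf' hf1k hak hN hNb
  obtain ⟨ψ, hψ0, hψ, hψk⟩ := exists_primitive_contDiffOn_ball hNk
  obtain ⟨h, hh0, hh, hhk⟩ := exists_primitive_contDiffOn_ball hψk.exp
  have hdf : ∀ x ∈ ball (0 : ℝ) δ, HasDerivAt f (deriv f x) x := fun x hx =>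
    (hfd.differentiableAt (isOpen_ball.mem_nhds hx)).hasDerivAt
  have hddf : ∀ x ∈ ball (0 : ℝ) δ, HasDerivAt (deriv f) (deriv (deriv f) x) x := fun x hx =>
    (hf1d.differentiableAt (isOpen_ball.mem_nhds hx)).hasDerivAt
  have hcocycle : ∀ x ∈ ball (0 : ℝ) δ,
      deriv f x * Real.exp (ψ (f x)) = deriv f 0 * Real.exp (ψ x) := by
    intro x hx
    have hG : ∀ y ∈ ball (0 : ℝ) δ,
        HasDerivAt (fun z => deriv f z * Real.exp (ψ (f z) - ψ z)) 0 y := by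
      intro y hy
      refine ((hddf y hy).mul
        ((((hψ _ (hmaps hy)).comp y (hdf y hy)).sub (hψ y hy)).exp)).congr_deriv ?_
      simp only [Function.comp_apply, Pi.sub_apply]
      rw [hN y hy]
      have := hne y hy
      field_simp
      ring
    have := eq_zero_value_of_hasDerivAt_zero_ball hG hx
    simp only [hf0, sub_self, Real.exp_zero, mul_one] at this
    rw [← this, mul_assoc, ← Real.exp_add, sub_add_cancel]
  refine ⟨h, hhk, hh0, ?_, fun x hx => ?_⟩
  · rw [(hh 0 h0).deriv]
    exact (Real.exp_pos _).ne'
  · have hG : ∀ y ∈ ball (0 : ℝ) δ, HasDerivAt (fun z => h (f z) - deriv f 0 * h z) 0 y := by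
      intro y hy
      refine (((hh _ (hmaps hy)).comp y (hdf y hy)).sub
        ((hh y hy).const_mul (deriv f 0))).congr_deriv ?_
      linarith [hcocycle y hy]
    have := eq_zero_value_of_hasDerivAt_zero_ball hG hx
    simp only [hf0, hh0, mul_zero, sub_self] at this
    linarith

theorem exists_linearization_of_contracting {r : ℕ} (hr : 2 ≤ r) {f : ℝ → ℝ}
    (hf : ContDiffAt ℝ r f 0) (hf0 : f 0 = 0) (hne : deriv f 0 ≠ 0) (hlt : ‖deriv f 0‖ < 1) :
    ∃ h : ℝ → ℝ, ContDiffAt ℝ r h 0 ∧ h 0 = 0 ∧ deriv h 0 ≠ 0 ∧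
      ∀ᶠ x in 𝓝 0, h (f x) = deriv f 0 * h x := by
  have hev := hf.eventually (by simp)
  obtain ⟨k, rfl⟩ := Nat.exists_eq_add_of_le' hr
  obtain ⟨c, hlc, hc1⟩ := exists_between hlt
  have hc : 0 < c := (norm_nonneg _).trans_lt hlc
  have hcont : ContinuousAt (deriv f) 0 :=
    (hf.derivWithin (m := 0) (by exact_mod_cast Nat.le_add_left 1 (k + 1))).continuousAt
  obtain ⟨δ, hδ, hball⟩ := Metric.eventually_nhds_iff_ball.1
    (hev.and ((hcont.norm.eventually_lt_const hlc).and (hcont.eventually_ne hne)))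
  obtain ⟨h, hhk, hh0, hh', hh⟩ := exists_linearization_on_ball hδ hc hc1
    (fun x hx => (hball x hx).1.contDiffWithinAt) hf0 (fun x hx => (hball x hx).2.1.le)
    (fun x hx => (hball x hx).2.2)
  exact ⟨h, hhk.contDiffAt (ball_mem_nhds 0 hδ), hh0, hh',
    Filter.eventually_of_mem (ball_mem_nhds 0 hδ) hh⟩

theorem exists_openPartialHomeomorph_of_deriv_ne_zero {r : ℕ} (hr : r ≠ 0) {φ : ℝ → ℝ} {x : ℝ}
    (hφ : ContDiffAt ℝ r φ x) (hne : deriv φ x ≠ 0) :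
    ∃ e : OpenPartialHomeomorph ℝ ℝ, ⇑e = φ ∧ x ∈ e.source ∧ ContDiffAt ℝ r e.symm (φ x) := by
  have hr' : (r : WithTop ℕ∞) ≠ 0 := by exact_mod_cast hr
  have hF := ((hφ.hasStrictDerivAt hr').hasStrictFDerivAt_equiv hne).hasFDerivAt
  exact ⟨hφ.toOpenPartialHomeomorph φ hF hr', rfl, hφ.mem_toOpenPartialHomeomorph_source hF hr',
    hφ.to_localInverse hF hr'⟩

theorem exists_linearization_of_hyperbolic {r : ℕ} (hr : 2 ≤ r) {f : ℝ → ℝ}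
    (hf : ContDiffAt ℝ r f 0) (hf0 : f 0 = 0) (hne : deriv f 0 ≠ 0) (hne1 : ‖deriv f 0‖ ≠ 1) :
    ∃ h : ℝ → ℝ, ContDiffAt ℝ r h 0 ∧ h 0 = 0 ∧ deriv h 0 ≠ 0 ∧
      ∀ᶠ x in 𝓝 0, h (f x) = deriv f 0 * h x := by
  rcases lt_or_gt_of_ne hne1 with hlt | hgt
  · exact exists_linearization_of_contracting hr hf hf0 hne hlt
  have hr0 : r ≠ 0 := by omega
  obtain ⟨e, he, hsrc, hsymm⟩ := exists_openPartialHomeomorph_of_deriv_ne_zero hr0 hf hne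
  have hleft : ∀ᶠ x in 𝓝 0, e.symm (f x) = x := he ▸ e.eventually_left_inverse hsrc
  have hstrict : HasStrictDerivAt f (deriv f 0) 0 :=
    hf.hasStrictDerivAt (by exact_mod_cast hr0)
  have hg' : deriv e.symm 0 = (deriv f 0)⁻¹ := by
    simpa only [hf0] using (hstrict.to_local_left_inverse hne hleft).hasDerivAt.deriv
  have hg0 : e.symm 0 = 0 := by simpa only [hf0] using hleft.self_of_nhds
  rw [hf0] at hsymm
  obtain ⟨h, hh, hh0, hh', hconj⟩ := exists_linearization_of_contracting hr hsymm hg0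
    (by rw [hg']; exact inv_ne_zero hne)
    (by rw [hg', norm_inv]; exact inv_lt_one_of_one_lt₀ hgt)
  refine ⟨h, hh, hh0, hh', ?_⟩
  have hft : Tendsto f (𝓝 0) (𝓝 0) := by simpa only [hf0] using hf.continuousAt.tendsto
  filter_upwards [hleft, hft.eventually hconj] with x hx hxc
  rw [hx, hg'] at hxc
  rw [hxc, mul_inv_cancel_left₀ hne]


/-- Sternberg's linearization theorem: a `C^r` map (`r ≥ 2`) with a hyperbolic
fixed point at `0` with multiplier `l ∉ {-1, 0, 1}` is locally `C^r`-conjugate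
to the linear map `y ↦ l * y`. -/
theorem sternberg_linearization (r : ℕ) (hr : 2 ≤ r) (f : ℝ → ℝ)
    (hf : ContDiff ℝ r f) (hf0 : f 0 = 0) (l : ℝ) (hl : deriv f 0 = l)
    (hl1 : l ≠ -1) (hl0 : l ≠ 0) (hl2 : l ≠ 1) :
    ∃ U V : Set ℝ, IsOpen U ∧ IsOpen V ∧ (0 : ℝ) ∈ U ∧ (0 : ℝ) ∈ V ∧
      ∃ h h' : ℝ → ℝ, Set.BijOn h U V ∧
        ContDiffOn ℝ r h U ∧ ContDiffOn ℝ r h' V ∧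
        (∀ x ∈ U, h' (h x) = x) ∧ (∀ y ∈ V, h (h' y) = y) ∧
        h 0 = 0 ∧
        ∀ x ∈ U, f x ∈ U → h (f x) = l * h x := by
  subst hl
  have hne1 : ‖deriv f 0‖ ≠ 1 := by
    rw [Real.norm_eq_abs]
    intro h
    rcases eq_or_eq_neg_of_abs_eq h with h | h
    · exact hl2 h
    · exact hl1 h
  obtain ⟨h, hh, hh0, hh', hconj⟩ :=
    exists_linearization_of_hyperbolic hr hf.contDiffAt hf0 hl0 hne1
  obtain ⟨e, he, hsrc, hsymm⟩ :=
    exists_openPartialHomeomorph_of_deriv_ne_zero (by omega) hh hh'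
  have hr' : (r : WithTop ℕ∞) ≠ (⊤ : ℕ∞) := by simp
  rw [hh0] at hsymm
  obtain ⟨I, hI, hIo, hI0⟩ := _root_.eventually_nhds_iff.1 ((hh.eventually hr').and hconj)
  obtain ⟨W, hW, hWo, hW0⟩ := _root_.eventually_nhds_iff.1 (hsymm.eventually hr')
  have hes : e.symm 0 = 0 := by simpa only [he, hh0] using e.left_inv hsrc
  have het : (0 : ℝ) ∈ e.target := by simpa only [he, hh0] using e.map_source hsrc
  subst he
  refine ⟨(e.source ∩ e ⁻¹' W) ∩ I, (e.target ∩ e.symm ⁻¹' I) ∩ W,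
    (e.isOpen_inter_preimage hWo).inter hIo, (e.isOpen_inter_preimage_symm hIo).inter hWo,
    ⟨⟨hsrc, by simpa [hh0] using hW0⟩, hI0⟩, ⟨⟨het, by simpa [hes] using hI0⟩, hW0⟩,
    e, e.symm, ?_, fun x hx => (hI x hx.2).1.contDiffWithinAt,
    fun y hy => (hW y hy.2).contDiffWithinAt, fun x hx => e.left_inv hx.1.1,
    fun y hy => e.right_inv hy.1.1, hh0, fun x hx _ => (hI x hx.2).2⟩
  refine Set.InvOn.bijOn (f' := e.symm)
    ⟨fun x hx => e.left_inv hx.1.1, fun y hy => e.right_inv hy.1.1⟩ ?_ ?_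
  · rintro x ⟨⟨hx, hxW⟩, hxI⟩
    exact ⟨⟨e.map_source hx, by simpa [e.left_inv hx] using hxI⟩, hxW⟩
  · rintro y ⟨⟨hy, hyI⟩, hyW⟩
    exact ⟨⟨e.map_target hy, by simpa [e.right_inv hy] using hyW⟩, hyI⟩
end

section
/- Let r ≥ 4 and let f : ℝ × ℝ → ℝ be a C^r family of one-dimensional maps satisfying the saddle-node conditions f(0,0) = 0, ∂f/∂x(0,0) = 1, ∂f/∂μ(0,0) > 0, and ∂²f/∂x²(0,0) < 0. Let g(y,ν,a) = y + ν − y² + a y³. Then there exist δ > 0, open neighbourhoods N and M of 0 in ℝ, and continuous functions F, G : (0,δ) → ℝ with F(μ) → 0 as μ → 0⁺ and G(μ) → (2 ∂³f/∂x³(0,0)) / (3 (∂²f/∂x²(0,0))²) as μ → 0⁺, such that for all μ ∈ (0,δ): f(·,μ) restricted to N has exactly two fixed points in N, g(·,F(μ),G(μ)) restricted to M has exactly two fixed points in M, and f(·,μ)|_N and g(·,F(μ),G(μ))|_M are C^{r−1}-conjugate on the basins (within N and M respectively) of their corresponding fixed points. -/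
/-- The basin of attraction of a fixed point `xs` of `f` within `N`: points
whose forward orbits remain in `N` and converge to `xs`. -/
def fwdBasin (f : ℝ → ℝ) (N : Set ℝ) (xs : ℝ) : Set ℝ :=
  {x | (∀ n : ℕ, f^[n] x ∈ N) ∧
    Filter.Tendsto (fun n => f^[n] x) Filter.atTop (nhds xs)}

/-- The basin of repulsion of a fixed point `xs` of `f` within `N`: points
admitting a backward orbit that remains in `N` and converges to `xs`. -/
def bwdBasin (f : ℝ → ℝ) (N : Set ℝ) (xs : ℝ) : Set ℝ :=
  {x | ∃ u : ℕ → ℝ, u 0 = x ∧ (∀ n, f (u (n + 1)) = u n) ∧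
    (∀ n, u n ∈ N) ∧ Filter.Tendsto u Filter.atTop (nhds xs)}

/-- `f` on `A` is `C^n`-conjugate to `g` on `B` by a conjugacy matching the
point `x₀ ∈ A` with `y₀ ∈ B`. -/
def CrConjOn (n : ℕ∞) (f g : ℝ → ℝ) (A B : Set ℝ) (x₀ y₀ : ℝ) : Prop :=
  ∃ h h' : ℝ → ℝ, Set.BijOn h A B ∧
    ContDiffOn ℝ n h A ∧ ContDiffOn ℝ n h' B ∧
    (∀ x ∈ A, h' (h x) = x) ∧ (∀ y ∈ B, h (h' y) = y) ∧
    h x₀ = y₀ ∧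
    ∀ x ∈ A, f x ∈ A → h (f x) = g (h x)

open Set Filter Topology

/-! ### Calculus on open intervals -/

theorem exists_Icc_subset_of_isOpen_ordConnected {J : Set ℝ} (hJ : IsOpen J) (hc : J.OrdConnected)
    {x y : ℝ} (hx : x ∈ J) (hy : y ∈ J) :
    ∃ a b, a < x ∧ x < b ∧ a < y ∧ y < b ∧ Icc a b ⊆ J := by
  have hmin : min x y ∈ J := by rcases min_choice x y with h | h <;> rwa [h]
  have hmax : max x y ∈ J := by rcases max_choice x y with h | h <;> rwa [h]
  obtain ⟨a, ha, ha'⟩ := Filter.nonempty_of_mem (inter_mem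
    (mem_nhdsWithin_of_mem_nhds (hJ.mem_nhds hmin)) (self_mem_nhdsWithin (s := Iio (min x y))))
  obtain ⟨b, hb, hb'⟩ := Filter.nonempty_of_mem (inter_mem
    (mem_nhdsWithin_of_mem_nhds (hJ.mem_nhds hmax)) (self_mem_nhdsWithin (s := Ioi (max x y))))
  rw [mem_Iio, lt_min_iff] at ha'
  rw [mem_Ioi, max_lt_iff] at hb'
  exact ⟨a, b, ha'.1, hb'.1, ha'.2, hb'.2, hc.out ha hb⟩

theorem ContDiffOn.succ_of_hasDerivAt {n : ℕ} {J : Set ℝ} (hJ : IsOpen J) {f f' : ℝ → ℝ}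
    (hf : ∀ x ∈ J, HasDerivAt f (f' x) x) (hf' : ContDiffOn ℝ n f' J) :
    ContDiffOn ℝ (n + 1 : ℕ) f J := by
  push_cast
  rw [contDiffOn_succ_iff_deriv_of_isOpen hJ]
  refine ⟨fun x hx => (hf x hx).differentiableAt.differentiableWithinAt, by simp, ?_⟩
  exact hf'.congr fun x hx => (hf x hx).deriv

theorem ContDiffOn.hasDerivAt_of_isOpen {n : ℕ} {J : Set ℝ} (hJ : IsOpen J) {f : ℝ → ℝ}
    (hf : ContDiffOn ℝ (n + 1 : ℕ) f J) {x : ℝ} (hx : x ∈ J) : HasDerivAt f (deriv f x) x :=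
  ((hf.differentiableOn (by simp)).differentiableAt (hJ.mem_nhds hx)).hasDerivAt

theorem ContDiffOn.deriv_of_isOpen_nat {n : ℕ} {J : Set ℝ} (hJ : IsOpen J) {f : ℝ → ℝ}
    (hf : ContDiffOn ℝ (n + 1 : ℕ) f J) : ContDiffOn ℝ n (deriv f) J :=
  hf.deriv_of_isOpen hJ (by simp)

theorem ContinuousOn.hasDerivAt_integral {J : Set ℝ} (hJ : IsOpen J) (hc : J.OrdConnected)
    {V : ℝ → ℝ} (hV : ContinuousOn V J) {x₀ x : ℝ} (hx₀ : x₀ ∈ J) (hx : x ∈ J) :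
    HasDerivAt (fun z => ∫ t in x₀..z, V t) (V x) x := by
  apply intervalIntegral.integral_hasDerivAt_right
  · exact (hV.mono (hc.uIcc_subset hx₀ hx)).intervalIntegrable
  · exact hV.stronglyMeasurableAtFilter hJ x hx
  · exact hV.continuousAt (hJ.mem_nhds hx)

/-- A smooth function with nonvanishing derivative, injective on an open set, has a smooth inverse
on the image. -/
theorem ContDiffOn.exists_leftInverse {n : ℕ} {I : Set ℝ} (hI : IsOpen I) {Φ : ℝ → ℝ}
    (hΦ : ContDiffOn ℝ (n + 1 : ℕ) Φ I) (hinj : InjOn Φ I) (hd : ∀ x ∈ I, deriv Φ x ≠ 0) :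
    ∃ X : ℝ → ℝ, (∀ x ∈ I, X (Φ x) = x) ∧ ContDiffOn ℝ (n + 1 : ℕ) X (Φ '' I) := by
  refine ⟨Function.invFunOn Φ I, fun x hx => hinj.leftInvOn_invFunOn hx, ?_⟩
  rintro _ ⟨x, hx, rfl⟩
  apply ContDiffAt.contDiffWithinAt
  have hat : ContDiffAt ℝ (n + 1 : ℕ) Φ x := hΦ.contDiffAt (hI.mem_nhds hx)
  have hder : HasDerivAt Φ (deriv Φ x) x := hΦ.hasDerivAt_of_isOpen hI hx
  have hn : ((n + 1 : ℕ) : WithTop ℕ∞) ≠ 0 := by simp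
  have hfd : HasFDerivAt Φ
      (ContinuousLinearEquiv.unitsEquivAut ℝ (Units.mk0 _ (hd x hx)) : ℝ →L[ℝ] ℝ) x := by
    have heq : (ContinuousLinearEquiv.unitsEquivAut ℝ (Units.mk0 _ (hd x hx)) : ℝ →L[ℝ] ℝ) =
        ContinuousLinearMap.toSpanSingleton ℝ (deriv Φ x) := by
      ext; simp
    rw [heq]
    exact hder.hasFDerivAt
  have hloc := hat.to_localInverse hfd hn
  refine hloc.congr_of_eventuallyEq ?_
  have h1 : ∀ᶠ y in 𝓝 (Φ x), Φ (hat.localInverse hfd hn y) = y :=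
    (hat.hasStrictFDerivAt' hfd hn).eventually_right_inverse
  have hx' : hat.localInverse hfd hn (Φ x) = x := ContDiffAt.localInverse_apply_image hat hfd hn
  have h2 : ∀ᶠ y in 𝓝 (Φ x), hat.localInverse hfd hn y ∈ I := by
    apply hloc.continuousAt.eventually_mem
    rw [hx']; exact hI.mem_nhds hx
  filter_upwards [h1, h2] with y hy1 hy2
  conv_lhs => rw [← hy1]
  exact hinj.leftInvOn_invFunOn hy2

/-! ### The linear cohomological equation -/

theorem pow_mul_mem_Icc {l a b t : ℝ} (hl0 : 0 ≤ l) (hl1 : l ≤ 1) (ha : a ≤ 0) (hb : 0 ≤ b)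
    (ht : t ∈ Icc a b) (k : ℕ) : l ^ k * t ∈ Icc a b := by
  have h0 : 0 ≤ l ^ k := pow_nonneg hl0 k
  have h1 : l ^ k ≤ 1 := pow_le_one₀ hl0 hl1
  constructor
  · nlinarith [ht.1, ht.2]
  · nlinarith [ht.1, ht.2]

/-- The weighted sums `∑ θᵏ w(lᵏ t)` are as smooth as `w`. -/
theorem contDiffOn_tsum_pow_mul {J : Set ℝ} (hJ : IsOpen J) (hc : J.OrdConnected)
    (h0 : (0 : ℝ) ∈ J) {l : ℝ} (hl0 : 0 ≤ l) (hl1 : l ≤ 1) (n : ℕ) :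
    ∀ (θ : ℝ) (w : ℝ → ℝ), 0 ≤ θ → θ < 1 → ContDiffOn ℝ n w J →
      ContDiffOn ℝ n (fun t => ∑' k : ℕ, θ ^ k * w (l ^ k * t)) J := by
  induction n with
  | zero =>
    intro θ w hθ0 hθ1 hw
    simp only [CharP.cast_eq_zero, contDiffOn_zero] at hw ⊢
    intro z hz
    obtain ⟨a, b, ha, hb, haz, hzb, hab⟩ := exists_Icc_subset_of_isOpen_ordConnected hJ hc h0 hz
    obtain ⟨K, hK⟩ := isCompact_Icc.exists_bound_of_continuousOn (hw.mono hab)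
    have hmem := fun t (ht : t ∈ Icc a b) k => pow_mul_mem_Icc hl0 hl1 ha.le hb.le ht k
    have : ContinuousOn (fun t => ∑' k : ℕ, θ ^ k * w (l ^ k * t)) (Icc a b) := by
      refine continuousOn_tsum (u := fun k => θ ^ k * K) (fun k => ?_)
        ((summable_geometric_of_lt_one hθ0 hθ1).mul_right K) (fun k t ht => ?_)
      · exact continuousOn_const.mul ((hw.mono hab).comp (by fun_prop) fun t ht => hmem t ht k)
      · rw [norm_mul, Real.norm_of_nonneg (pow_nonneg hθ0 k)]
        exact mul_le_mul_of_nonneg_left (hK _ (hmem t ht k)) (pow_nonneg hθ0 k)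
    exact (this.continuousAt (Icc_mem_nhds haz hzb)).continuousWithinAt
  | succ n ih =>
    intro θ w hθ0 hθ1 hw
    have hd := hw.deriv_of_isOpen_nat hJ
    refine ContDiffOn.succ_of_hasDerivAt hJ (f' := fun t => ∑' k : ℕ, (θ * l) ^ k *
      deriv w (l ^ k * t)) ?_ (ih (θ * l) (deriv w) (by positivity) (by nlinarith) hd)
    intro z hz
    obtain ⟨a, b, ha, hb, haz, hzb, hab⟩ := exists_Icc_subset_of_isOpen_ordConnected hJ hc h0 hz
    obtain ⟨K, hK⟩ := isCompact_Icc.exists_bound_of_continuousOn (hd.continuousOn.mono hab)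
    have hmem := fun t (ht : t ∈ Ioo a b) k =>
      pow_mul_mem_Icc hl0 hl1 ha.le hb.le (Ioo_subset_Icc_self ht) k
    refine hasDerivAt_tsum_of_isPreconnected (u := fun k => θ ^ k * K) (t := Ioo a b) (y₀ := 0)
      (g := fun k t => θ ^ k * w (l ^ k * t)) (g' := fun k t => (θ * l) ^ k * deriv w (l ^ k * t))
      ((summable_geometric_of_lt_one hθ0 hθ1).mul_right K) isOpen_Ioo isPreconnected_Ioo
      (fun k t ht => ?_) (fun k t ht => ?_) ⟨ha, hb⟩ ?_ ⟨haz, hzb⟩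
    · have h1 : HasDerivAt (fun t : ℝ => l ^ k * t) (l ^ k) t := by
        simpa using (hasDerivAt_id t).const_mul (l ^ k)
      have := ((hw.hasDerivAt_of_isOpen hJ (hab (hmem t ht k))).comp t h1).const_mul (θ ^ k)
      refine this.congr_deriv ?_
      rw [mul_pow]; ring
    · rw [norm_mul, mul_pow, Real.norm_of_nonneg (by positivity)]
      have h1 : l ^ k ≤ 1 := pow_le_one₀ hl0 hl1
      have hp := pow_nonneg hθ0 k
      have hp' := pow_nonneg hl0 k
      have hKk := hK _ (hmem t ht k)
      calc θ ^ k * l ^ k * ‖deriv w (l ^ k * t)‖ ≤ θ ^ k * 1 * K := by gcongr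
        _ = θ ^ k * K := by ring
    · simpa using (summable_geometric_of_lt_one hθ0 hθ1).mul_right (w 0)

/-- The cohomological equation `U z - U (l z) = w z` for a linear contraction has solutions as
smooth as `w`. -/
theorem exists_contDiffOn_cohomological {J : Set ℝ} (hJ : IsOpen J) (hc : J.OrdConnected)
    (h0 : (0 : ℝ) ∈ J) {l : ℝ} (hl0 : 0 ≤ l) (hl1 : l < 1) {n : ℕ} {w : ℝ → ℝ}
    (hw : ContDiffOn ℝ (n + 1 : ℕ) w J) (hw0 : w 0 = 0) :
    ∃ U : ℝ → ℝ, ContDiffOn ℝ (n + 1 : ℕ) U J ∧ U 0 = 0 ∧ ∀ z ∈ J, U z - U (l * z) = w z := by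
  have hlJ : ∀ z ∈ J, l * z ∈ J := by
    intro z hz
    obtain ⟨a, b, ha, hb, haz, hzb, hab⟩ := exists_Icc_subset_of_isOpen_ordConnected hJ hc h0 hz
    simpa using hab (pow_mul_mem_Icc hl0 hl1.le ha.le hb.le ⟨haz.le, hzb.le⟩ 1)
  have hd := hw.deriv_of_isOpen_nat hJ
  set X : ℝ → ℝ := fun t => ∑' k : ℕ, l ^ k * deriv w (l ^ k * t) with hX
  have hXs : ContDiffOn ℝ n X J := contDiffOn_tsum_pow_mul hJ hc h0 hl0 hl1.le n l _ hl0 hl1 hd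
  have hXeq : ∀ z ∈ J, X z = deriv w z + l * X (l * z) := by
    intro z hz
    obtain ⟨a, b, ha, hb, haz, hzb, hab⟩ := exists_Icc_subset_of_isOpen_ordConnected hJ hc h0 hz
    obtain ⟨K, hK⟩ := isCompact_Icc.exists_bound_of_continuousOn (hd.continuousOn.mono hab)
    have hs : Summable fun k : ℕ => l ^ k * deriv w (l ^ k * z) := by
      refine Summable.of_norm_bounded ((summable_geometric_of_lt_one hl0 hl1).mul_right K) ?_
      intro k
      rw [norm_mul, Real.norm_of_nonneg (pow_nonneg hl0 k)]
      exact mul_le_mul_of_nonneg_left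
        (hK _ (pow_mul_mem_Icc hl0 hl1.le ha.le hb.le ⟨haz.le, hzb.le⟩ k)) (pow_nonneg hl0 k)
    simp only [hX]
    rw [hs.tsum_eq_zero_add, ← tsum_mul_left]
    simp only [pow_zero, one_mul, pow_succ]
    congr 2
    ext k
    rw [mul_assoc (l ^ k) l z]; ring
  have hU : ∀ z ∈ J, HasDerivAt (fun z => ∫ t in (0 : ℝ)..z, X t) (X z) z :=
    fun z hz => hXs.continuousOn.hasDerivAt_integral hJ hc h0 hz
  refine ⟨fun z => ∫ t in (0 : ℝ)..z, X t, ContDiffOn.succ_of_hasDerivAt hJ hU hXs, by simp, ?_⟩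
  have hV : ∀ z ∈ J, HasDerivAt (fun z => (∫ t in (0 : ℝ)..z, X t) - ∫ t in (0 : ℝ)..(l * z), X t)
      (deriv w z) z := by
    intro z hz
    have h1 : HasDerivAt (fun t : ℝ => l * t) l z := by
      simpa using (hasDerivAt_id z).const_mul l
    refine ((hU z hz).sub ((hU _ (hlJ z hz)).comp z h1)).congr_deriv ?_
    rw [hXeq z hz]; ring
  refine hJ.eqOn_of_deriv_eq hc.isPreconnected
    (fun z hz => (hV z hz).differentiableAt.differentiableWithinAt)
    (hw.differentiableOn (by simp)) (fun z hz => (hV z hz).deriv) h0 ?_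
  simp [hw0]

/-! ### Linearization of an attracting fixed point of an interval map -/

/-- An increasing `C^n` self-map `ψ` of the interval `(A, B)` all of whose orbits converge
monotonically to the hyperbolic fixed point `x₀`, and whose image is `(A, e)`. -/
structure IsAttracting (n : ℕ) (ψ : ℝ → ℝ) (A B e x₀ : ℝ) : Prop where
  lt_fix : A < x₀
  fix_lt : x₀ < e
  e_lt : e < B
  contDiffOn : ContDiffOn ℝ n ψ (Ioo A B)
  deriv_pos : ∀ x ∈ Ioo A B, 0 < deriv ψ x
  map_fix : ψ x₀ = x₀
  deriv_fix_lt : deriv ψ x₀ < 1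
  left : ∀ x ∈ Ioo A x₀, x < ψ x ∧ ψ x < x₀
  right : ∀ x ∈ Ioo x₀ B, x₀ < ψ x ∧ ψ x < x
  image_eq : ψ '' Ioo A B = Ioo A e

namespace IsAttracting

variable {n : ℕ} {ψ : ℝ → ℝ} {A B e x₀ : ℝ}

theorem fix_mem (h : IsAttracting n ψ A B e x₀) : x₀ ∈ Ioo A B :=
  ⟨h.lt_fix, h.fix_lt.trans h.e_lt⟩

theorem mapsTo (h : IsAttracting n ψ A B e x₀) {x : ℝ} (hx : x ∈ Ioo A B) : ψ x ∈ Ioo A B := by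
  have : ψ x ∈ Ioo A e := h.image_eq ▸ mem_image_of_mem ψ hx
  exact ⟨this.1, this.2.trans h.e_lt⟩

theorem mapsTo_Icc (h : IsAttracting n ψ A B e x₀) {a b : ℝ} (ha : a ∈ Ioo A x₀)
    (hb : b ∈ Ioo x₀ B) {x : ℝ} (hx : x ∈ Icc a b) : ψ x ∈ Icc a b := by
  rcases lt_trichotomy x x₀ with hlt | rfl | hgt
  · have := h.left x ⟨ha.1.trans_le hx.1, hlt⟩
    exact ⟨hx.1.trans this.1.le, (this.2.trans hb.1).le⟩
  · rw [h.map_fix]; exact hx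
  · have := h.right x ⟨hgt, hx.2.trans_lt hb.2⟩
    exact ⟨(ha.2.trans this.1).le, this.2.le.trans hx.2⟩

theorem iterate_mem_Icc (h : IsAttracting n ψ A B e x₀) {a b : ℝ} (ha : a ∈ Ioo A x₀)
    (hb : b ∈ Ioo x₀ B) {x : ℝ} (hx : x ∈ Icc a b) (k : ℕ) : ψ^[k] x ∈ Icc a b := by
  induction k with
  | zero => exact hx
  | succ k ih => rw [Function.iterate_succ_apply']; exact h.mapsTo_Icc ha hb ih

theorem iterate_mem (h : IsAttracting n ψ A B e x₀) {x : ℝ} (hx : x ∈ Ioo A B) (k : ℕ) :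
    ψ^[k] x ∈ Ioo A B := by
  induction k with
  | zero => exact hx
  | succ k ih => rw [Function.iterate_succ_apply']; exact h.mapsTo ih

theorem exists_contraction (h : IsAttracting (n + 1) ψ A B e x₀) {a b : ℝ} (ha : a ∈ Ioo A x₀)
    (hb : b ∈ Ioo x₀ B) :
    ∃ θ : ℝ, 0 ≤ θ ∧ θ < 1 ∧ ∀ x ∈ Icc a b, |ψ x - x₀| ≤ θ * |x - x₀| := by
  have hsub : Icc a b ⊆ Ioo A B := Icc_subset_Ioo ha.1 hb.2
  have hcont : ContinuousOn (fun x => |dslope ψ x₀ x|) (Icc a b) := by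
    refine ContinuousOn.abs (((continuousOn_dslope (Ioo_mem_nhds h.fix_mem.1 h.fix_mem.2)).2
      ⟨h.contDiffOn.continuousOn, ?_⟩).mono hsub)
    exact (h.contDiffOn.hasDerivAt_of_isOpen isOpen_Ioo h.fix_mem).differentiableAt
  obtain ⟨c, hc, hmax⟩ := isCompact_Icc.exists_isMaxOn ⟨x₀, ha.2.le, hb.1.le⟩ hcont
  refine ⟨|dslope ψ x₀ c|, abs_nonneg _, ?_, fun x hx => ?_⟩
  · rcases lt_trichotomy c x₀ with hlt | rfl | hgt
    · have := h.left c ⟨ha.1.trans_le hc.1, hlt⟩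
      rw [dslope_of_ne _ hlt.ne, slope_def_field, h.map_fix, abs_div, div_lt_one
        (abs_pos.2 (sub_ne_zero.2 hlt.ne)), abs_of_neg (by linarith), abs_of_neg (by linarith)]
      linarith
    · rw [dslope_same, abs_of_pos (h.deriv_pos _ h.fix_mem)]
      exact h.deriv_fix_lt
    · have := h.right c ⟨hgt, hc.2.trans_lt hb.2⟩
      rw [dslope_of_ne _ hgt.ne', slope_def_field, h.map_fix, abs_div, div_lt_one
        (abs_pos.2 (sub_ne_zero.2 hgt.ne')), abs_of_pos (by linarith), abs_of_pos (by linarith)]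
      linarith
  · have h1 : ψ x - x₀ = (x - x₀) * dslope ψ x₀ x := by
      have := sub_smul_dslope ψ x₀ x
      rw [smul_eq_mul, h.map_fix] at this
      exact this.symm
    rw [h1, abs_mul, mul_comm]
    exact mul_le_mul_of_nonneg_right (hmax hx) (abs_nonneg _)

theorem exists_iterate_bound (h : IsAttracting (n + 1) ψ A B e x₀) {a b : ℝ} (ha : a ∈ Ioo A x₀)
    (hb : b ∈ Ioo x₀ B) :
    ∃ θ : ℝ, 0 ≤ θ ∧ θ < 1 ∧ ∀ x ∈ Icc a b, ∀ k : ℕ, |ψ^[k] x - x₀| ≤ θ ^ k * |x - x₀| := by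
  obtain ⟨θ, h0, h1, hθ⟩ := h.exists_contraction ha hb
  refine ⟨θ, h0, h1, fun x hx k => ?_⟩
  induction k with
  | zero => simp
  | succ k ih =>
    rw [Function.iterate_succ_apply']
    calc _ ≤ θ * |ψ^[k] x - x₀| := hθ _ (h.iterate_mem_Icc ha hb hx k)
      _ ≤ θ * (θ ^ k * |x - x₀|) := by gcongr
      _ = _ := by ring

theorem exists_Icc (h : IsAttracting n ψ A B e x₀) {x : ℝ} (hx : x ∈ Ioo A B) :
    ∃ a b, a ∈ Ioo A x₀ ∧ b ∈ Ioo x₀ B ∧ x ∈ Ioo a b := by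
  obtain ⟨a, b, h1, h2, h3, h4, h5⟩ :=
    exists_Icc_subset_of_isOpen_ordConnected isOpen_Ioo ordConnected_Ioo h.fix_mem hx
  exact ⟨a, b, ⟨(h5 ⟨le_rfl, (h1.trans h2).le⟩).1, h1⟩, ⟨h2, (h5 ⟨(h1.trans h2).le, le_rfl⟩).2⟩,
    h3, h4⟩

theorem tendsto_iterate (h : IsAttracting (n + 1) ψ A B e x₀) {x : ℝ} (hx : x ∈ Ioo A B) :
    Tendsto (fun k => ψ^[k] x) atTop (𝓝 x₀) := by
  obtain ⟨a, b, ha, hb, hxab⟩ := h.exists_Icc hx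
  obtain ⟨θ, h0, h1, hθ⟩ := h.exists_iterate_bound ha hb
  rw [tendsto_iff_dist_tendsto_zero]
  refine squeeze_zero (g := fun k => θ ^ k * |x - x₀|) (fun _ => dist_nonneg)
    (fun k => hθ x (Ioo_subset_Icc_self hxab) k) ?_
  simpa using (tendsto_pow_atTop_nhds_zero_of_lt_one h0 h1).mul_const |x - x₀|

/-- The sum of a function vanishing at the fixed point along orbits solves the cohomological
equation. -/
theorem exists_continuousOn_cohomological (h : IsAttracting (n + 1) ψ A B e x₀) {u : ℝ → ℝ}
    (hu : ContinuousOn u (Ioo A B)) (hud : DifferentiableAt ℝ u x₀) (hu0 : u x₀ = 0) :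
    ∃ U : ℝ → ℝ, ContinuousOn U (Ioo A B) ∧ U x₀ = 0 ∧
      ∀ x ∈ Ioo A B, U x - U (ψ x) = u x := by
  have hbound : ∀ a ∈ Ioo A x₀, ∀ b ∈ Ioo x₀ B, ∃ v : ℕ → ℝ, Summable v ∧
      ∀ k, ∀ x ∈ Icc a b, ‖u (ψ^[k] x)‖ ≤ v k := by
    intro a ha b hb
    have hsub : Icc a b ⊆ Ioo A B := Icc_subset_Ioo ha.1 hb.2
    obtain ⟨θ, h0, h1, hθ⟩ := h.exists_iterate_bound ha hb
    obtain ⟨K, hK⟩ := isCompact_Icc.exists_bound_of_continuousOn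
      (((continuousOn_dslope (Ioo_mem_nhds h.fix_mem.1 h.fix_mem.2)).2 ⟨hu, hud⟩).mono hsub)
    have hK0 : 0 ≤ K := (norm_nonneg _).trans (hK x₀ ⟨ha.2.le, hb.1.le⟩)
    refine ⟨fun k => θ ^ k * ((b - a) * K),
      (summable_geometric_of_lt_one h0 h1).mul_right _, fun k x hx => ?_⟩
    have hx' := h.iterate_mem_Icc ha hb hx k
    have h2 : u (ψ^[k] x) = (ψ^[k] x - x₀) * dslope u x₀ (ψ^[k] x) := by
      have := sub_smul_dslope u x₀ (ψ^[k] x)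
      rw [smul_eq_mul, hu0, sub_zero] at this
      exact this.symm
    have h3 : |x - x₀| ≤ b - a := by
      rw [abs_le]; constructor <;> linarith [hx.1, hx.2, ha.2, hb.1]
    have hp := pow_nonneg h0 k
    rw [h2, norm_mul, Real.norm_eq_abs]
    calc _ ≤ θ ^ k * |x - x₀| * K :=
          mul_le_mul (hθ x hx k) (hK _ hx') (norm_nonneg _) (by positivity)
      _ ≤ θ ^ k * (b - a) * K := by gcongr
      _ = _ := by ring
  have hit : ∀ k, ContinuousOn (ψ^[k]) (Ioo A B) := by
    intro k
    induction k with
    | zero => exact continuousOn_id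
    | succ k ih =>
      rw [Function.iterate_succ']
      exact h.contDiffOn.continuousOn.comp ih fun x hx => h.iterate_mem hx k
  refine ⟨fun x => ∑' k, u (ψ^[k] x), fun x hx => ?_, ?_, fun x hx => ?_⟩
  · obtain ⟨a, b, ha, hb, hxab⟩ := h.exists_Icc hx
    obtain ⟨v, hv, hv'⟩ := hbound a ha b hb
    have hsub : Icc a b ⊆ Ioo A B := Icc_subset_Ioo ha.1 hb.2
    have : ContinuousOn (fun x => ∑' k, u (ψ^[k] x)) (Icc a b) :=
      continuousOn_tsum (fun k => hu.comp ((hit k).mono hsub)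
        fun x hx => h.iterate_mem (hsub hx) k) hv hv'
    exact (this.continuousAt (Icc_mem_nhds hxab.1 hxab.2)).continuousWithinAt
  · have : ∀ k, ψ^[k] x₀ = x₀ := fun k => Function.iterate_fixed h.map_fix k
    simp [this, hu0]
  · obtain ⟨a, b, ha, hb, hxab⟩ := h.exists_Icc hx
    obtain ⟨v, hv, hv'⟩ := hbound a ha b hb
    have hs : Summable fun k => u (ψ^[k] x) :=
      Summable.of_norm_bounded hv fun k => hv' k x (Ioo_subset_Icc_self hxab)
    simp only
    rw [hs.tsum_eq_zero_add]
    simp [Function.iterate_succ_apply]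

end IsAttracting

theorem StrictMonoOn.isOpen_image_Ioo {Φ : ℝ → ℝ} {A B : ℝ} (hm : StrictMonoOn Φ (Ioo A B))
    (hc : ContinuousOn Φ (Ioo A B)) : IsOpen (Φ '' Ioo A B) := by
  rw [isOpen_iff_mem_nhds]
  rintro _ ⟨x, hx, rfl⟩
  obtain ⟨a, b, hax, hxb, -, -, hab⟩ :=
    exists_Icc_subset_of_isOpen_ordConnected isOpen_Ioo ordConnected_Ioo hx hx
  have ha : a ∈ Ioo A B := hab ⟨le_rfl, (hax.trans hxb).le⟩
  have hb : b ∈ Ioo A B := hab ⟨(hax.trans hxb).le, le_rfl⟩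
  filter_upwards [Icc_mem_nhds (hm ha hx hax) (hm hx hb hxb)] with y hy
  obtain ⟨z, hz, rfl⟩ := intermediate_value_Icc (hax.trans hxb).le (hc.mono hab) hy
  exact mem_image_of_mem _ (hab hz)

namespace IsAttracting

variable {n : ℕ} {ψ : ℝ → ℝ} {A B e x₀ : ℝ}

/-- Two continuous solutions of a cohomological equation agree if they agree at the fixed point. -/
theorem eqOn_of_cohomological (h : IsAttracting (n + 1) ψ A B e x₀) {U V : ℝ → ℝ}
    (hU : ContinuousOn U (Ioo A B)) (hV : ContinuousOn V (Ioo A B)) (h0 : U x₀ = V x₀)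
    (hUV : ∀ x ∈ Ioo A B, U x - U (ψ x) = V x - V (ψ x)) : EqOn U V (Ioo A B) := by
  intro x hx
  have hk : ∀ k, U (ψ^[k] x) - V (ψ^[k] x) = U x - V x := by
    intro k
    induction k with
    | zero => rfl
    | succ k ih =>
      rw [Function.iterate_succ_apply']
      linarith [hUV _ (h.iterate_mem hx k)]
  have hx₀ := Ioo_mem_nhds h.fix_mem.1 h.fix_mem.2
  have ht := ((hU.continuousAt hx₀).sub (hV.continuousAt hx₀)).tendsto.comp (h.tendsto_iterate hx)
  simp only [Function.comp_def, Pi.sub_apply] at ht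
  have := tendsto_nhds_unique (tendsto_const_nhds (x := U x - V x) (f := atTop (α := ℕ)))
    (ht.congr hk)
  linarith

/-- A primitive of `exp U`, for `U` the solution of the cohomological equation of
`log (ψ' / ψ' x₀)`, is as smooth as `ψ`. -/
theorem contDiffOn_of_cohomological (h : IsAttracting (n + 1) ψ A B e x₀) {u U Φ : ℝ → ℝ} {l : ℝ}
    (hl0 : 0 < l) (hl1 : l < 1) {N : ℕ}
    (hu : ContDiffOn ℝ N u (Ioo A B)) (hu0 : u x₀ = 0)
    (hU : ContinuousOn U (Ioo A B)) (hU0 : U x₀ = 0)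
    (hUu : ∀ x ∈ Ioo A B, U x - U (ψ x) = u x)
    (hΦ : ∀ x ∈ Ioo A B, HasDerivAt Φ (Real.exp (U x)) x) (hΦ0 : Φ x₀ = 0)
    (hΦψ : ∀ x ∈ Ioo A B, Φ (ψ x) = l * Φ x) :
    ∀ j ≤ N, ContDiffOn ℝ j U (Ioo A B) := by
  have hcΦ : ContinuousOn Φ (Ioo A B) := fun x hx => (hΦ x hx).continuousAt.continuousWithinAt
  have hmono : StrictMonoOn Φ (Ioo A B) := by
    refine strictMonoOn_of_deriv_pos (convex_Ioo A B) hcΦ fun x hx => ?_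
    rw [interior_Ioo] at hx
    rw [(hΦ x hx).deriv]; exact Real.exp_pos _
  have hJ : IsOpen (Φ '' Ioo A B) := hmono.isOpen_image_Ioo hcΦ
  have hJc : (Φ '' Ioo A B).OrdConnected := (isPreconnected_Ioo.image Φ hcΦ).ordConnected
  have hJ0 : (0 : ℝ) ∈ Φ '' Ioo A B := ⟨x₀, h.fix_mem, hΦ0⟩
  intro j
  induction j with
  | zero => intro _; simpa using hU
  | succ j ih =>
    intro hj
    have hΦs : ContDiffOn ℝ (j + 1 : ℕ) Φ (Ioo A B) :=
      ContDiffOn.succ_of_hasDerivAt isOpen_Ioo hΦ (ih (by omega)).exp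
    obtain ⟨X, hX, hXs⟩ := hΦs.exists_leftInverse isOpen_Ioo hmono.injOn
      fun x hx => by rw [(hΦ x hx).deriv]; exact (Real.exp_pos _).ne'
    have hXm : MapsTo X (Φ '' Ioo A B) (Ioo A B) := by
      rintro _ ⟨x, hx, rfl⟩; rwa [hX x hx]
    have hX0 : X 0 = x₀ := by rw [← hΦ0, hX x₀ h.fix_mem]
    obtain ⟨W, hWs, hW0, hW⟩ := exists_contDiffOn_cohomological hJ hJc hJ0 hl0.le hl1
      (w := u ∘ X) ((hu.of_le (by exact_mod_cast hj)).comp hXs hXm) (by simp [hX0, hu0])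
    have hWΦ : ContDiffOn ℝ (j + 1 : ℕ) (W ∘ Φ) (Ioo A B) := hWs.comp hΦs (mapsTo_image _ _)
    refine hWΦ.congr (h.eqOn_of_cohomological hU hWΦ.continuousOn (by simp [hU0, hΦ0, hW0]) ?_)
    intro x hx
    have := hW (Φ x) (mem_image_of_mem _ hx)
    simp only [Function.comp_apply, hX x hx] at this ⊢
    rw [hUu x hx, hΦψ x hx, this]

/-- Smooth linearization of a hyperbolic attracting fixed point on its whole basin. -/
theorem exists_linearization (h : IsAttracting (n + 2) ψ A B e x₀) :
    ∃ Φ : ℝ → ℝ, ContDiffOn ℝ (n + 2 : ℕ) Φ (Ioo A B) ∧ (∀ x ∈ Ioo A B, 0 < deriv Φ x) ∧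
      StrictMonoOn Φ (Ioo A B) ∧ Φ x₀ = 0 ∧
      (∀ x ∈ Ioo A B, Φ (ψ x) = deriv ψ x₀ * Φ x) ∧ ∃ d > 0, Φ '' Ioo A B = Iio d := by
  set l := deriv ψ x₀ with hl
  have hl0 : 0 < l := h.deriv_pos _ h.fix_mem
  have hl1 : l < 1 := h.deriv_fix_lt
  set u : ℝ → ℝ := fun x => Real.log (deriv ψ x / l) with hudef
  have hu : ContDiffOn ℝ (n + 1 : ℕ) u (Ioo A B) :=
    ((h.contDiffOn.deriv_of_isOpen_nat isOpen_Ioo).div_const l).log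
      fun x hx => (div_pos (h.deriv_pos x hx) hl0).ne'
  have hu0 : u x₀ = 0 := by simp [hudef, ← hl, div_self hl0.ne']
  obtain ⟨U, hU, hU0, hUu⟩ := h.exists_continuousOn_cohomological hu.continuousOn
    (hu.hasDerivAt_of_isOpen isOpen_Ioo h.fix_mem).differentiableAt hu0
  have hΦ : ∀ x ∈ Ioo A B, HasDerivAt (fun z => ∫ t in x₀..z, Real.exp (U t)) (Real.exp (U x)) x :=
    fun x hx => hU.rexp.hasDerivAt_integral isOpen_Ioo ordConnected_Ioo h.fix_mem hx
  set Φ : ℝ → ℝ := fun z => ∫ t in x₀..z, Real.exp (U t) with hΦdef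
  have hΦ0 : Φ x₀ = 0 := by simp [hΦdef]
  have hcomp : ∀ x ∈ Ioo A B, HasDerivAt (fun x => Φ (ψ x)) (l * Real.exp (U x)) x := by
    intro x hx
    refine ((hΦ _ (h.mapsTo hx)).comp x
      (h.contDiffOn.hasDerivAt_of_isOpen isOpen_Ioo hx)).congr_deriv ?_
    have h1 : U x = U (ψ x) + u x := by linarith [hUu x hx]
    rw [h1, Real.exp_add, hudef, Real.exp_log (div_pos (h.deriv_pos x hx) hl0)]
    field_simp
  have hΦψ : ∀ x ∈ Ioo A B, Φ (ψ x) = l * Φ x := by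
    have hr : ∀ x ∈ Ioo A B, HasDerivAt (fun x => l * Φ x) (l * Real.exp (U x)) x :=
      fun x hx => (hΦ x hx).const_mul l
    refine isOpen_Ioo.eqOn_of_deriv_eq isPreconnected_Ioo
      (fun z hz => (hcomp z hz).differentiableAt.differentiableWithinAt)
      (fun z hz => (hr z hz).differentiableAt.differentiableWithinAt)
      (fun z hz => by rw [(hcomp z hz).deriv, (hr z hz).deriv]) h.fix_mem ?_
    simp [h.map_fix, hΦ0]
  have hUs : ContDiffOn ℝ (n + 1 : ℕ) U (Ioo A B) :=
    h.contDiffOn_of_cohomological hl0 hl1 hu hu0 hU hU0 hUu hΦ hΦ0 hΦψ (n + 1) le_rfl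
  have hΦs : ContDiffOn ℝ (n + 2 : ℕ) Φ (Ioo A B) :=
    ContDiffOn.succ_of_hasDerivAt isOpen_Ioo hΦ hUs.exp
  have hpos : ∀ x ∈ Ioo A B, 0 < deriv Φ x := fun x hx => by
    rw [(hΦ x hx).deriv]; exact Real.exp_pos _
  have hmono : StrictMonoOn Φ (Ioo A B) := by
    refine strictMonoOn_of_deriv_pos (convex_Ioo A B) hΦs.continuousOn fun x hx => ?_
    rw [interior_Ioo] at hx
    exact hpos x hx
  refine ⟨Φ, hΦs, hpos, hmono, hΦ0, hΦψ, ?_⟩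
  have he : e ∈ Ioo A B := ⟨h.lt_fix.trans h.fix_lt, h.e_lt⟩
  have hd : 0 < Φ e := hΦ0 ▸ hmono h.fix_mem he h.fix_lt
  have hJ : IsOpen (Φ '' Ioo A B) := hmono.isOpen_image_Ioo hΦs.continuousOn
  have hJc : (Φ '' Ioo A B).OrdConnected :=
    (isPreconnected_Ioo.image Φ hΦs.continuousOn).ordConnected
  have hJ0 : (0 : ℝ) ∈ Φ '' Ioo A B := ⟨x₀, h.fix_mem, hΦ0⟩
  have hback : ∀ y, l * y ∈ Φ '' Ioo A B → l * y < Φ e → y ∈ Φ '' Ioo A B := by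
    rintro y ⟨x, hx, hxy⟩ hlt
    have hxe : x < e := (hmono.lt_iff_lt hx he).1 (hxy ▸ hlt)
    obtain ⟨z, hz, rfl⟩ : x ∈ ψ '' Ioo A B := h.image_eq ▸ ⟨hx.1, hxe⟩
    rw [hΦψ z hz] at hxy
    exact ⟨z, hz, mul_left_cancel₀ hl0.ne' hxy⟩
  refine ⟨Φ e / l, by positivity, Subset.antisymm ?_ fun y hy => ?_⟩
  · rintro _ ⟨x, hx, rfl⟩
    rw [mem_Iio, lt_div_iff₀ hl0, mul_comm, ← hΦψ x hx]
    have : ψ x ∈ Ioo A e := h.image_eq ▸ mem_image_of_mem ψ hx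
    exact hmono (h.mapsTo hx) he this.2
  · rw [mem_Iio, lt_div_iff₀ hl0, mul_comm] at hy
    rcases le_or_gt 0 y with hy0 | hy0
    · exact hback y (hJc.out hJ0 (mem_image_of_mem Φ he) ⟨by positivity, hy.le⟩) hy
    · have hev : ∀ᶠ k : ℕ in atTop, l ^ k * y ∈ Φ '' Ioo A B := by
        have ht : Tendsto (fun k : ℕ => l ^ k * y) atTop (𝓝 0) := by
          simpa using (tendsto_pow_atTop_nhds_zero_of_lt_one hl0.le hl1).mul_const y
        exact ht.eventually_mem (hJ.mem_nhds hJ0)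
      obtain ⟨k, hk⟩ := hev.exists
      induction k with
      | zero => simpa using hk
      | succ k ih =>
        refine ih (hback _ (by convert hk using 1; ring) ?_)
        have : 0 < l ^ k := pow_pos hl0 k
        have : l * (l ^ k * y) < 0 := by
          rw [← mul_assoc]; exact mul_neg_of_pos_of_neg (by positivity) hy0
        linarith

/-- Two attracting interval maps with the same multiplier are smoothly conjugate on their basins. -/
theorem exists_conjugacy {φ : ℝ → ℝ} {A' B' e' y₀ : ℝ} (h : IsAttracting (n + 2) ψ A B e x₀)
    (h' : IsAttracting (n + 2) φ A' B' e' y₀) (hmul : deriv ψ x₀ = deriv φ y₀) :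
    ∃ k k' : ℝ → ℝ, MapsTo k (Ioo A B) (Ioo A' B') ∧ MapsTo k' (Ioo A' B') (Ioo A B) ∧
      ContDiffOn ℝ (n + 2 : ℕ) k (Ioo A B) ∧ ContDiffOn ℝ (n + 2 : ℕ) k' (Ioo A' B') ∧
      (∀ x ∈ Ioo A B, k' (k x) = x) ∧ (∀ y ∈ Ioo A' B', k (k' y) = y) ∧ k x₀ = y₀ ∧
      ∀ x ∈ Ioo A B, k (ψ x) = φ (k x) := by
  obtain ⟨Φ, hΦs, hΦd, hΦm, hΦ0, hΦψ, d, hd, hΦi⟩ := h.exists_linearization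
  obtain ⟨Ψ, hΨs, hΨd, hΨm, hΨ0, hΨφ, d', hd', hΨi⟩ := h'.exists_linearization
  obtain ⟨X, hX, hXs⟩ := hΦs.exists_leftInverse isOpen_Ioo hΦm.injOn fun x hx => (hΦd x hx).ne'
  obtain ⟨Y, hY, hYs⟩ := hΨs.exists_leftInverse isOpen_Ioo hΨm.injOn fun x hx => (hΨd x hx).ne'
  have hXm : ∀ z < d, X z ∈ Ioo A B ∧ Φ (X z) = z := by
    intro z hz
    obtain ⟨x, hx, rfl⟩ : z ∈ Φ '' Ioo A B := hΦi ▸ hz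
    rw [hX x hx]; exact ⟨hx, rfl⟩
  have hYm : ∀ z < d', Y z ∈ Ioo A' B' ∧ Ψ (Y z) = z := by
    intro z hz
    obtain ⟨x, hx, rfl⟩ : z ∈ Ψ '' Ioo A' B' := hΨi ▸ hz
    rw [hY x hx]; exact ⟨hx, rfl⟩
  have hΦlt : ∀ x ∈ Ioo A B, d' / d * Φ x < d' := by
    intro x hx
    have : Φ x < d := by have := mem_image_of_mem Φ hx; rwa [hΦi] at this
    rw [div_mul_eq_mul_div, div_lt_iff₀ hd]; gcongr
  have hΨlt : ∀ y ∈ Ioo A' B', d / d' * Ψ y < d := by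
    intro x hx
    have : Ψ x < d' := by have := mem_image_of_mem Ψ hx; rwa [hΨi] at this
    rw [div_mul_eq_mul_div, div_lt_iff₀ hd']; gcongr
  refine ⟨fun x => Y (d' / d * Φ x), fun y => X (d / d' * Ψ y), fun x hx => (hYm _ (hΦlt x hx)).1,
    fun y hy => (hXm _ (hΨlt y hy)).1, ?_, ?_, fun x hx => ?_, fun y hy => ?_, ?_, fun x hx => ?_⟩
  · exact hYs.comp (contDiffOn_const.mul hΦs) fun x hx => hΨi ▸ hΦlt x hx
  · exact hXs.comp (contDiffOn_const.mul hΨs) fun y hy => hΦi ▸ hΨlt y hy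
  · simp only
    rw [(hYm _ (hΦlt x hx)).2, ← mul_assoc, show d / d' * (d' / d) = 1 by field_simp, one_mul,
      hX x hx]
  · simp only
    rw [(hXm _ (hΨlt y hy)).2, ← mul_assoc, show d' / d * (d / d') = 1 by field_simp, one_mul,
      hY y hy]
  · simp only
    rw [hΦ0, mul_zero, ← hΨ0, hY y₀ h'.fix_mem]
  · have hk := hYm _ (hΦlt x hx)
    refine hΨm.injOn (hYm _ (hΦlt _ (h.mapsTo hx))).1 (h'.mapsTo hk.1) ?_
    simp only
    rw [hΨφ _ hk.1, hk.2, (hYm _ (hΦlt _ (h.mapsTo hx))).2, hΦψ x hx, hmul]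
    ring

end IsAttracting

/-! ### Concave increasing maps with two fixed points -/

/-- An increasing, strictly concave `C^n` map on `[-ε, ε]` with fixed points `m < p`. -/
structure IsSaddleNodeMap (n : ℕ) (φ : ℝ → ℝ) (ε m p : ℝ) : Prop where
  contDiff : ContDiff ℝ n φ
  deriv_pos : ∀ x ∈ Icc (-ε) ε, 0 < deriv φ x
  concave : StrictConcaveOn ℝ (Icc (-ε) ε) φ
  neg_lt : -ε < m
  lt : m < p
  lt_eps : p < ε
  map_left : φ m = m
  map_right : φ p = p

namespace IsSaddleNodeMap

variable {n : ℕ} {φ : ℝ → ℝ} {ε m p : ℝ}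

theorem left_mem (h : IsSaddleNodeMap n φ ε m p) : m ∈ Icc (-ε) ε :=
  ⟨h.neg_lt.le, (h.lt.trans h.lt_eps).le⟩

theorem right_mem (h : IsSaddleNodeMap n φ ε m p) : p ∈ Icc (-ε) ε :=
  ⟨(h.neg_lt.trans h.lt).le, h.lt_eps.le⟩

theorem strictMonoOn (h : IsSaddleNodeMap n φ ε m p) : StrictMonoOn φ (Icc (-ε) ε) :=
  strictMonoOn_of_deriv_pos (convex_Icc _ _) h.contDiff.continuous.continuousOn
    fun x hx => h.deriv_pos x (interior_subset hx)

theorem map_lt_of_lt_left (h : IsSaddleNodeMap n φ ε m p) {x : ℝ} (hx : x ∈ Icc (-ε) ε)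
    (hxm : x < m) : φ x < x := by
  have := h.concave.slope_anti_adjacent hx h.right_mem hxm h.lt
  rw [h.map_left, h.map_right, div_self (sub_ne_zero.2 h.lt.ne'), lt_div_iff₀ (by linarith)] at this
  linarith

theorem lt_map (h : IsSaddleNodeMap n φ ε m p) {x : ℝ} (hmx : m < x) (hxp : x < p) : x < φ x := by
  have := h.concave.slope_anti_adjacent h.left_mem h.right_mem hmx hxp
  rw [h.map_left, h.map_right, div_lt_div_iff₀ (by linarith) (by linarith)] at this
  nlinarith [h.lt]

theorem map_lt_of_right_lt (h : IsSaddleNodeMap n φ ε m p) {x : ℝ} (hx : x ∈ Icc (-ε) ε)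
    (hpx : p < x) : φ x < x := by
  have := h.concave.slope_anti_adjacent h.left_mem hx h.lt hpx
  rw [h.map_left, h.map_right, div_self (sub_ne_zero.2 h.lt.ne'), div_lt_iff₀ (by linarith)] at this
  linarith

theorem eq_or_eq_of_map_eq (h : IsSaddleNodeMap n φ ε m p) {x : ℝ} (hx : x ∈ Icc (-ε) ε)
    (hfix : φ x = x) : x = m ∨ x = p := by
  rcases lt_trichotomy x m with h1 | h1 | h1
  · exact absurd hfix (h.map_lt_of_lt_left hx h1).ne
  · exact Or.inl h1
  · rcases lt_trichotomy x p with h2 | h2 | h2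
    · exact absurd hfix (h.lt_map h1 h2).ne'
    · exact Or.inr h2
    · exact absurd hfix (h.map_lt_of_right_lt hx h2).ne

theorem deriv_right_lt (h : IsSaddleNodeMap (n + 1) φ ε m p) : deriv φ p < 1 := by
  have := h.concave.deriv_lt_slope h.left_mem h.right_mem h.lt
    (h.contDiff.differentiable (by simp) p)
  rwa [slope_def_field, h.map_left, h.map_right, div_self (sub_ne_zero.2 h.lt.ne')] at this

theorem lt_deriv_left (h : IsSaddleNodeMap (n + 1) φ ε m p) : 1 < deriv φ m := by
  have := h.concave.slope_lt_deriv h.left_mem h.right_mem h.lt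
    (h.contDiff.differentiable (by simp) m)
  rwa [slope_def_field, h.map_left, h.map_right, div_self (sub_ne_zero.2 h.lt.ne')] at this

theorem isAttracting_right (h : IsSaddleNodeMap (n + 1) φ ε m p) :
    IsAttracting (n + 1) φ m ε (φ ε) p where
  lt_fix := h.lt
  fix_lt := by
    conv_lhs => rw [← h.map_right]
    exact h.strictMonoOn h.right_mem ⟨h.right_mem.1.trans h.right_mem.2, le_rfl⟩ h.lt_eps
  e_lt := h.map_lt_of_right_lt ⟨h.right_mem.1.trans h.right_mem.2, le_rfl⟩ h.lt_eps
  contDiffOn := h.contDiff.contDiffOn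
  deriv_pos x hx := h.deriv_pos x ⟨(h.neg_lt.trans hx.1).le, hx.2.le⟩
  map_fix := h.map_right
  deriv_fix_lt := h.deriv_right_lt
  left x hx := by
    refine ⟨h.lt_map hx.1 hx.2, ?_⟩
    conv_rhs => rw [← h.map_right]
    exact h.strictMonoOn ⟨(h.neg_lt.trans hx.1).le, (hx.2.trans h.lt_eps).le⟩ h.right_mem hx.2
  right x hx := by
    have hx' : x ∈ Icc (-ε) ε := ⟨h.right_mem.1.trans hx.1.le, hx.2.le⟩
    refine ⟨?_, h.map_lt_of_right_lt hx' hx.1⟩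
    conv_lhs => rw [← h.map_right]
    exact h.strictMonoOn h.right_mem hx' hx.1
  image_eq := by
    have hε : ε ∈ Icc (-ε) ε := ⟨h.right_mem.1.trans h.right_mem.2, le_rfl⟩
    apply Subset.antisymm
    · rintro _ ⟨x, hx, rfl⟩
      have hx' : x ∈ Icc (-ε) ε := ⟨(h.neg_lt.trans hx.1).le, hx.2.le⟩
      refine ⟨?_, h.strictMonoOn hx' hε hx.2⟩
      conv_lhs => rw [← h.map_left]
      exact h.strictMonoOn h.left_mem hx' hx.1
    · have := intermediate_value_Ioo (h.lt.trans h.lt_eps).le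
        (h.contDiff.continuous.continuousOn (s := Icc m ε))
      rwa [h.map_left] at this

/-- The reflected inverse branch is attracting at the reflection of the left fixed point. -/
theorem exists_isAttracting_left (h : IsSaddleNodeMap (n + 1) φ ε m p) :
    ∃ X : ℝ → ℝ, ∃ e : ℝ, IsAttracting (n + 1) (fun t => -X (-t)) (-p) ε e (-m) ∧
      deriv (fun t => -X (-t)) (-m) = (deriv φ m)⁻¹ ∧
      (∀ x ∈ Ioo (-ε) ε, X (φ x) = x) ∧
      ∀ y ∈ Ioo (-ε) p, X y ∈ Ioo (-ε) p ∧ φ (X y) = y := by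
  have hε : -ε ∈ Icc (-ε) ε := ⟨le_rfl, h.right_mem.1.trans h.right_mem.2⟩
  have hsub : Ioo (-ε) ε ⊆ Icc (-ε) ε := Ioo_subset_Icc_self
  have hm : m ∈ Ioo (-ε) ε := ⟨h.neg_lt, h.lt.trans h.lt_eps⟩
  obtain ⟨X, hX, hXs⟩ := h.contDiff.contDiffOn.exists_leftInverse (isOpen_Ioo (a := -ε) (b := ε))
    (h.strictMonoOn.injOn.mono hsub) fun x hx => (h.deriv_pos x (hsub hx)).ne'
  have hneg : φ (-ε) < -ε := h.map_lt_of_lt_left hε h.neg_lt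
  have hpre : ∀ y ∈ Ico (-ε) p, ∃ x ∈ Ioo (-ε) p, φ x = y := by
    intro y hy
    have := intermediate_value_Ioo (h.neg_lt.trans h.lt).le
        (h.contDiff.continuous.continuousOn (s := Icc (-ε) p))
    rw [h.map_right] at this
    exact this ⟨hneg.trans_le hy.1, hy.2⟩
  have hXm : ∀ y ∈ Ioo (-ε) p, X y ∈ Ioo (-ε) p ∧ φ (X y) = y := by
    intro y hy
    obtain ⟨x, hx, rfl⟩ := hpre y ⟨hy.1.le, hy.2⟩
    rw [hX x ⟨hx.1, hx.2.trans h.lt_eps⟩]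
    exact ⟨hx, rfl⟩
  have himg : Ioo (-ε) p ⊆ φ '' Ioo (-ε) ε := by
    intro y hy
    obtain ⟨x, hx, rfl⟩ := hpre y ⟨hy.1.le, hy.2⟩
    exact ⟨x, ⟨hx.1, hx.2.trans h.lt_eps⟩, rfl⟩
  have hXfix : X m = m := by
    conv_lhs => rw [← h.map_left]
    exact hX m hm
  have hXder : ∀ y ∈ Ioo (-ε) p, HasDerivAt X (deriv φ (X y))⁻¹ y := by
    intro y hy
    refine HasDerivAt.of_local_left_inverse
      ((hXs.mono himg).continuousOn.continuousAt (Ioo_mem_nhds hy.1 hy.2))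
      (h.contDiff.differentiable (by simp) _).hasDerivAt
      (h.deriv_pos _ ⟨(hXm y hy).1.1.le, ((hXm y hy).1.2.trans h.lt_eps).le⟩).ne' ?_
    filter_upwards [Ioo_mem_nhds hy.1 hy.2] with z hz using (hXm z hz).2
  have hmem : ∀ t, t ∈ Ioo (-p) ε → -t ∈ Ioo (-ε) p := fun t ht =>
    ⟨by linarith [ht.2], by linarith [ht.1]⟩
  have hder : ∀ t ∈ Ioo (-p) ε, HasDerivAt (fun t => -X (-t)) (deriv φ (X (-t)))⁻¹ t := by
    intro t ht
    exact ((hXder _ (hmem t ht)).comp t (hasDerivAt_neg t)).neg.congr_deriv (by simp)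
  have hmm : -m ∈ Ioo (-p) ε := ⟨by linarith [h.lt], by linarith [h.neg_lt]⟩
  obtain ⟨c, hc, hcε⟩ := hpre (-ε) ⟨le_rfl, h.neg_lt.trans h.lt⟩
  have hc' : c ∈ Icc (-ε) ε := ⟨hc.1.le, (hc.2.trans h.lt_eps).le⟩
  have hcm : c < m := by
    by_contra! hmc
    have := h.strictMonoOn.monotoneOn h.left_mem hc' hmc
    rw [h.map_left, hcε] at this
    linarith [h.neg_lt]
  refine ⟨X, -c, ?_, ?_, hX, hXm⟩
  · refine ⟨by linarith [h.lt], by linarith, by linarith [hc.1], ?_, ?_, ?_, ?_, ?_, ?_, ?_⟩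
    · exact ((hXs.mono himg).comp contDiffOn_id.neg fun t ht => hmem t ht).neg
    · intro t ht
      rw [(hder t ht).deriv]
      have := (hXm _ (hmem t ht)).1
      exact inv_pos.2 (h.deriv_pos _ ⟨this.1.le, (this.2.trans h.lt_eps).le⟩)
    · simp [hXfix]
    · rw [(hder _ hmm).deriv, neg_neg, hXfix]
      exact inv_lt_one_of_one_lt₀ h.lt_deriv_left
    · intro t ht
      obtain ⟨h1, h2⟩ := hXm _ (hmem t ⟨ht.1, ht.2.trans hmm.2⟩)
      have h1' : X (-t) ∈ Icc (-ε) ε := ⟨h1.1.le, (h1.2.trans h.lt_eps).le⟩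
      have hgt : m < X (-t) := by
        by_contra! hle
        have := h.strictMonoOn.monotoneOn h1' h.left_mem hle
        rw [h.map_left, h2] at this
        linarith [ht.2]
      have := h.lt_map hgt h1.2
      constructor <;> linarith
    · intro t ht
      obtain ⟨h1, h2⟩ := hXm _ (hmem t ⟨hmm.1.trans ht.1, ht.2⟩)
      have h1' : X (-t) ∈ Icc (-ε) ε := ⟨h1.1.le, (h1.2.trans h.lt_eps).le⟩
      have hgt : X (-t) < m := by
        by_contra! hle
        have := h.strictMonoOn.monotoneOn h.left_mem h1' hle
        rw [h.map_left, h2] at this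
        linarith [ht.1]
      have := h.map_lt_of_lt_left h1' hgt
      constructor <;> linarith
    · apply Subset.antisymm
      · rintro _ ⟨t, ht, rfl⟩
        obtain ⟨h1, h2⟩ := hXm _ (hmem t ht)
        have h1' : X (-t) ∈ Icc (-ε) ε := ⟨h1.1.le, (h1.2.trans h.lt_eps).le⟩
        have : c < X (-t) := by
          rw [← h.strictMonoOn.lt_iff_lt hc' h1', hcε, h2]; linarith [ht.2]
        exact ⟨by simpa using h1.2, by simpa using this⟩
      · intro s hs
        have hs' : -s ∈ Icc (-ε) ε := ⟨by linarith [hs.2, hc.1], by linarith [hs.1, h.lt_eps]⟩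
        refine ⟨-φ (-s), ⟨?_, ?_⟩, ?_⟩
        · have := h.strictMonoOn hs' h.right_mem (by linarith [hs.1])
          rw [h.map_right] at this; linarith
        · have := h.strictMonoOn hc' hs' (by linarith [hs.2])
          linarith
        · simp only [neg_neg]
          rw [hX (-s) ⟨by linarith [hs.2, hc.1], by linarith [hs.1, h.lt_eps]⟩, neg_neg]
  · rw [(hder _ hmm).deriv, neg_neg, hXfix]

theorem fwdBasin_eq (h : IsSaddleNodeMap (n + 1) φ ε m p) :
    fwdBasin φ (Ioo (-ε) ε) p = Ioo m ε := by
  apply Subset.antisymm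
  · rintro x ⟨hN, ht⟩
    refine ⟨?_, (hN 0).2⟩
    by_contra! hxm
    have hle : ∀ k, φ^[k] x ≤ m := by
      intro k
      induction k with
      | zero => exact hxm
      | succ k ih =>
        rw [Function.iterate_succ_apply']
        have := h.strictMonoOn.monotoneOn (Ioo_subset_Icc_self (hN k)) h.left_mem ih
        rwa [h.map_left] at this
    exact absurd (le_of_tendsto' ht hle) (not_le.2 h.lt)
  · intro x hx
    refine ⟨fun k => ?_, h.isAttracting_right.tendsto_iterate hx⟩
    have := h.isAttracting_right.iterate_mem hx k
    exact ⟨h.neg_lt.trans this.1, this.2⟩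

theorem bwdBasin_eq (h : IsSaddleNodeMap (n + 1) φ ε m p) :
    bwdBasin φ (Ioo (-ε) ε) m = Ioo (-ε) p := by
  apply Subset.antisymm
  · rintro x ⟨u, rfl, hu, hN, ht⟩
    refine ⟨(hN 0).1, ?_⟩
    by_contra! hxp
    have hle : ∀ k, p ≤ u k := by
      intro k
      induction k with
      | zero => exact hxp
      | succ k ih =>
        by_contra! hlt
        have := h.strictMonoOn (Ioo_subset_Icc_self (hN (k + 1))) h.right_mem hlt
        rw [h.map_right, hu k] at this
        linarith
    exact absurd (ge_of_tendsto' ht hle) (not_le.2 h.lt)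
  · intro x hx
    obtain ⟨X, e, hatt, -, -, hXm⟩ := h.exists_isAttracting_left
    have hx' : -x ∈ Ioo (-p) ε := ⟨by linarith [hx.2], by linarith [hx.1]⟩
    have hmem : ∀ k, -(fun t => -X (-t))^[k] (-x) ∈ Ioo (-ε) p := by
      intro k
      have := hatt.iterate_mem hx' k
      exact ⟨by linarith [this.2], by linarith [this.1]⟩
    refine ⟨fun k => -(fun t => -X (-t))^[k] (-x), by simp, fun k => ?_, fun k => ?_, ?_⟩
    · simp only [Function.iterate_succ_apply', neg_neg]
      exact (hXm _ (hmem k)).2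
    · exact ⟨(hmem k).1, (hmem k).2.trans h.lt_eps⟩
    · simpa using (hatt.tendsto_iterate hx').neg

variable {γ : ℝ → ℝ} {ε' m' p' : ℝ}

theorem crConjOn_fwdBasin (h : IsSaddleNodeMap (n + 2) φ ε m p)
    (h' : IsSaddleNodeMap (n + 2) γ ε' m' p') (hd : deriv φ p = deriv γ p') :
    CrConjOn (n + 1 : ℕ) φ γ (fwdBasin φ (Ioo (-ε) ε) p) (fwdBasin γ (Ioo (-ε') ε') p') p p' := by
  obtain ⟨k, k', hk, hk', hks, hks', hl, hr, h0, hc⟩ :=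
    h.isAttracting_right.exists_conjugacy h'.isAttracting_right hd
  rw [h.fwdBasin_eq, h'.fwdBasin_eq]
  have hle : (((n + 1 : ℕ) : ℕ∞) : WithTop ℕ∞) ≤ (n + 2 : ℕ) :=
    (Nat.cast_le (α := WithTop ℕ∞)).2 (Nat.le_succ (n + 1))
  exact ⟨k, k', InvOn.bijOn ⟨hl, hr⟩ hk hk', hks.of_le hle, hks'.of_le hle, hl, hr, h0,
    fun x hx _ => hc x hx⟩

theorem crConjOn_bwdBasin (h : IsSaddleNodeMap (n + 2) φ ε m p)
    (h' : IsSaddleNodeMap (n + 2) γ ε' m' p') (hd : deriv φ m = deriv γ m') :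
    CrConjOn (n + 1 : ℕ) φ γ (bwdBasin φ (Ioo (-ε) ε) m) (bwdBasin γ (Ioo (-ε') ε') m') m m' := by
  obtain ⟨X, e, hX, hXd, hXφ, hXm⟩ := h.exists_isAttracting_left
  obtain ⟨Y, e', hY, hYd, hYγ, hYm⟩ := h'.exists_isAttracting_left
  obtain ⟨k, k', hk, hk', hks, hks', hl, hr, h0, hc⟩ :=
    hX.exists_conjugacy hY (by rw [hXd, hYd, hd])
  rw [h.bwdBasin_eq, h'.bwdBasin_eq]
  have hle : (((n + 1 : ℕ) : ℕ∞) : WithTop ℕ∞) ≤ (n + 2 : ℕ) :=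
    (Nat.cast_le (α := WithTop ℕ∞)).2 (Nat.le_succ (n + 1))
  have hmem : ∀ {a b x : ℝ}, x ∈ Ioo (-a) b → -x ∈ Ioo (-b) a := fun hx =>
    ⟨by linarith [hx.2], by linarith [hx.1]⟩
  have hl' : ∀ x ∈ Ioo (-ε) p, -k' (-(-k (-x))) = x := fun x hx => by
    rw [neg_neg, hl _ (hmem hx), neg_neg]
  have hr' : ∀ y ∈ Ioo (-ε') p', -k (-(-k' (-y))) = y := fun y hy => by
    rw [neg_neg, hr _ (hmem hy), neg_neg]
  refine ⟨fun x => -k (-x), fun y => -k' (-y), InvOn.bijOn (f' := fun y => -k' (-y)) ⟨hl', hr'⟩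
    (fun x hx => hmem (hk (hmem hx))) (fun x hx => hmem (hk' (hmem hx))), ?_, ?_, hl', hr',
    by simp [h0], fun x hx hφx => ?_⟩
  · exact ((hks.of_le hle).comp contDiffOn_id.neg fun x hx => hmem hx).neg
  · exact ((hks'.of_le hle).comp contDiffOn_id.neg fun x hx => hmem hx).neg
  · have h1 := hc _ (hmem hφx)
    simp only [neg_neg] at h1
    rw [hXφ x ⟨hx.1, hx.2.trans h.lt_eps⟩] at h1
    have h2 := (hYm _ (hmem (hk (hmem hφx)))).2
    simp only
    rw [h1, neg_neg, h2]

end IsSaddleNodeMap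

/-! ### The cubic normal form with prescribed multipliers -/

/-- The ratio `-y₋ / y₊` of the fixed points of the cubic normal form whose multipliers
`1 + κ β` and `1 - β` have deviations from `1` in the ratio `κ`. -/
noncomputable def fixRatio (κ : ℝ) : ℝ := 1 - κ + √(κ ^ 2 - κ + 1)

theorem continuous_fixRatio : Continuous fixRatio := by
  unfold fixRatio; fun_prop

theorem fixRatio_sq (κ : ℝ) : fixRatio κ * (2 - fixRatio κ) = κ * (2 * fixRatio κ - 1) := by
  have h := Real.sq_sqrt (show 0 ≤ κ ^ 2 - κ + 1 by nlinarith [sq_nonneg (κ - 1 / 2)])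
  unfold fixRatio
  nlinarith

theorem half_lt_fixRatio (κ : ℝ) : 1 / 2 < fixRatio κ := by
  have : κ - 1 / 2 < √(κ ^ 2 - κ + 1) := Real.lt_sqrt_of_sq_lt (by nlinarith)
  unfold fixRatio
  linarith

theorem fixRatio_one : fixRatio 1 = 1 := by simp [fixRatio]

theorem one_sub_fixRatio {κ : ℝ} (hκ : 0 < κ) :
    1 - fixRatio κ = (κ - 1) / (κ + √(κ ^ 2 - κ + 1)) := by
  have h := Real.sq_sqrt (show 0 ≤ κ ^ 2 - κ + 1 by nlinarith [sq_nonneg (κ - 1 / 2)])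
  have h0 := Real.sqrt_nonneg (κ ^ 2 - κ + 1)
  rw [eq_div_iff (by positivity)]
  unfold fixRatio
  nlinarith

theorem fixRatio_quadratic_pos (κ : ℝ) : 0 < 1 - fixRatio κ + fixRatio κ ^ 2 := by
  nlinarith [sq_nonneg (fixRatio κ - 1 / 2)]

/-- The positive fixed point of the cubic normal form with multipliers `1 + κ β`, `1 - β`. -/
noncomputable def rightFix (κ β : ℝ) : ℝ :=
  β * ((1 - fixRatio κ + fixRatio κ ^ 2) / ((1 + fixRatio κ) * (2 * fixRatio κ - 1)))

/-- The cubic coefficient of the normal form with multipliers `1 + κ β`, `1 - β`. -/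
noncomputable def cubicCoeff (κ β : ℝ) : ℝ :=
  (κ - 1) / β * ((1 + fixRatio κ) * (2 * fixRatio κ - 1) /
    ((κ + √(κ ^ 2 - κ + 1)) * (1 - fixRatio κ + fixRatio κ ^ 2) ^ 2))

/-- The parameter `ν` of the normal form with multipliers `1 + κ β`, `1 - β`. -/
noncomputable def unfoldingParam (κ β : ℝ) : ℝ :=
  rightFix κ β ^ 2 - cubicCoeff κ β * rightFix κ β ^ 3

theorem rightFix_pos {κ β : ℝ} (hβ : 0 < β) : 0 < rightFix κ β := by
  have h1 := half_lt_fixRatio κ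
  have h2 := fixRatio_quadratic_pos κ
  have h3 : 0 < 2 * fixRatio κ - 1 := by linarith
  have h4 : 0 < 1 + fixRatio κ := by linarith
  unfold rightFix
  positivity

theorem cubicCoeff_mul_rightFix {κ β : ℝ} (hκ : 0 < κ) (hβ : 0 < β) :
    cubicCoeff κ β * rightFix κ β =
      (1 - fixRatio κ) / (1 - fixRatio κ + fixRatio κ ^ 2) := by
  have h1 := half_lt_fixRatio κ
  have h2 := (fixRatio_quadratic_pos κ).ne'
  have h3 : fixRatio κ * 2 - 1 ≠ 0 := by linarith
  have h4 : 1 + fixRatio κ ≠ 0 := by linarith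
  have h5 : κ + √(κ ^ 2 - κ + 1) ≠ 0 := by positivity
  have h6 : κ - 1 = (1 - fixRatio κ) * (κ + √(κ ^ 2 - κ + 1)) := by
    rw [one_sub_fixRatio hκ, div_mul_cancel₀ _ h5]
  unfold cubicCoeff rightFix
  rw [h6]
  field_simp

theorem rightFix_mul {κ β : ℝ} :
    rightFix κ β * ((1 + fixRatio κ) * (2 * fixRatio κ - 1)) =
      β * (1 - fixRatio κ + fixRatio κ ^ 2) := by
  have h1 := half_lt_fixRatio κ
  have h3 : fixRatio κ * 2 - 1 ≠ 0 := by linarith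
  have h4 : 1 + fixRatio κ ≠ 0 := by linarith
  unfold rightFix
  field_simp

theorem unfoldingParam_eq_left {κ β : ℝ} (hκ : 0 < κ) (hβ : 0 < β) :
    unfoldingParam κ β = (-(fixRatio κ * rightFix κ β)) ^ 2 -
      cubicCoeff κ β * (-(fixRatio κ * rightFix κ β)) ^ 3 := by
  have h := cubicCoeff_mul_rightFix hκ hβ
  rw [eq_div_iff (fixRatio_quadratic_pos κ).ne'] at h
  unfold unfoldingParam
  linear_combination (-(1 + fixRatio κ) * rightFix κ β ^ 2) * h

theorem multiplier_right {κ β : ℝ} (hκ : 0 < κ) (hβ : 0 < β) :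
    1 - 2 * rightFix κ β + 3 * cubicCoeff κ β * rightFix κ β ^ 2 = 1 - β := by
  have h := cubicCoeff_mul_rightFix hκ hβ
  rw [eq_div_iff (fixRatio_quadratic_pos κ).ne'] at h
  refine mul_left_cancel₀ (fixRatio_quadratic_pos κ).ne' ?_
  linear_combination 3 * rightFix κ β * h - rightFix_mul (κ := κ) (β := β)

theorem multiplier_left {κ β : ℝ} (hκ : 0 < κ) (hβ : 0 < β) :
    1 - 2 * (-(fixRatio κ * rightFix κ β)) +
      3 * cubicCoeff κ β * (-(fixRatio κ * rightFix κ β)) ^ 2 = 1 + κ * β := by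
  have h := cubicCoeff_mul_rightFix hκ hβ
  rw [eq_div_iff (fixRatio_quadratic_pos κ).ne'] at h
  refine mul_left_cancel₀ (fixRatio_quadratic_pos κ).ne' ?_
  linear_combination 3 * fixRatio κ ^ 2 * rightFix κ β * h +
    rightFix κ β * (1 + fixRatio κ) * fixRatio_sq κ + κ * rightFix_mul (κ := κ) (β := β)

theorem hasDerivAt_cubic (ν a y : ℝ) :
    HasDerivAt (fun y : ℝ => y + ν - y ^ 2 + a * y ^ 3) (1 - 2 * y + 3 * a * y ^ 2) y := by
  have := (((hasDerivAt_id y).add_const ν).sub (hasDerivAt_pow 2 y)).add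
    ((hasDerivAt_pow 3 y).const_mul a)
  refine this.congr_deriv ?_
  norm_num
  ring

theorem isSaddleNodeMap_cubic {n : ℕ} {ν a A m p : ℝ} (hA : 1 ≤ A) (ha : |a| ≤ A)
    (hm : -(1 / (10 * A)) < m) (hmp : m < p) (hp : p < 1 / (10 * A))
    (hνm : ν = m ^ 2 - a * m ^ 3) (hνp : ν = p ^ 2 - a * p ^ 3) :
    IsSaddleNodeMap n (fun y => y + ν - y ^ 2 + a * y ^ 3) (1 / (10 * A)) m p := by
  have hbound : ∀ y ∈ Icc (-(1 / (10 * A))) (1 / (10 * A)), |a * y| ≤ 1 / 10 ∧ |y| ≤ 1 / 10 := by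
    intro y hy
    have h1 : |y| ≤ 1 / (10 * A) := abs_le.2 hy
    constructor
    · rw [abs_mul]
      calc |a| * |y| ≤ A * (1 / (10 * A)) := by gcongr
        _ = 1 / 10 := by field_simp
    · exact h1.trans (one_div_le_one_div_of_le (by norm_num) (by linarith))
  have hd : deriv (fun y : ℝ => y + ν - y ^ 2 + a * y ^ 3) =
      fun y => 1 - 2 * y + 3 * a * y ^ 2 := funext fun y => (hasDerivAt_cubic ν a y).deriv
  have hcont : ContDiff ℝ n (fun y : ℝ => y + ν - y ^ 2 + a * y ^ 3) := by fun_prop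
  refine ⟨hcont, fun y hy => ?_, ?_, hm, hmp, hp, by linarith, by linarith⟩
  · rw [hd]
    obtain ⟨h1, h2⟩ := hbound y hy
    rw [abs_le] at h1 h2
    nlinarith [abs_le.1 (show |a * y * y| ≤ 1 / 10 * (1 / 10) by
      rw [abs_mul]; exact mul_le_mul (abs_le.2 h1) (abs_le.2 h2) (abs_nonneg _) (by norm_num))]
  · refine strictConcaveOn_of_deriv2_neg (convex_Icc _ _) hcont.continuous.continuousOn
      fun y hy => ?_
    obtain ⟨h1, h2⟩ := hbound y (interior_subset hy)
    have h3 : HasDerivAt (fun y : ℝ => 1 - 2 * y + 3 * a * y ^ 2) (-2 + 6 * (a * y)) y := by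
      have := (((hasDerivAt_id y).const_mul 2).const_sub 1).add
        ((hasDerivAt_pow 2 y).const_mul (3 * a))
      refine this.congr_deriv ?_
      norm_num
      ring
    simp only [Function.iterate_succ, Function.iterate_zero, Function.comp_apply, id_eq]
    rw [hd, h3.deriv]
    linarith [(abs_le.1 h1).2]

/-! ### Partial derivatives of a family -/

theorem ContDiff.uncurry_deriv {n : ℕ} {f : ℝ → ℝ → ℝ}
    (hf : ContDiff ℝ (n + 1 : ℕ) (Function.uncurry f)) :
    ContDiff ℝ n (Function.uncurry fun x μ => deriv (fun x => f x μ) x) := by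
  have h : (Function.uncurry fun x μ => deriv (fun x => f x μ) x) =
      fun q => fderiv ℝ (Function.uncurry f) q (1, 0) := by
    ext ⟨x, μ⟩
    have h1 : HasFDerivAt (Function.uncurry f) (fderiv ℝ (Function.uncurry f) (x, μ)) (x, μ) :=
      ((hf.differentiable (by simp)) (x, μ)).hasFDerivAt
    exact (h1.comp_hasDerivAt x ((hasDerivAt_id x).prodMk (hasDerivAt_const x μ))).deriv
  rw [h]
  exact (hf.fderiv_right (by norm_cast)).clm_apply contDiff_const

theorem ContDiff.uncurry_iteratedDeriv {n : ℕ} (k : ℕ) {f : ℝ → ℝ → ℝ}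
    (hf : ContDiff ℝ (n + k : ℕ) (Function.uncurry f)) :
    ContDiff ℝ n (Function.uncurry fun x μ => iteratedDeriv k (fun x => f x μ) x) := by
  induction k generalizing n with
  | zero => simpa using hf
  | succ k ih =>
    simp only [iteratedDeriv_succ]
    exact (ih (n := n + 1) (by rwa [add_right_comm])).uncurry_deriv

/-! ### Dependence of the fixed points on the parameter -/

theorem tendsto_right_fix {ι : Type*} {l : Filter ι} {n : ℕ} {φ : ι → ℝ → ℝ} {ε p₀ : ℝ}
    {xm xp : ι → ℝ} (hφ : ∀ᶠ i in l, IsSaddleNodeMap n (φ i) ε (xm i) (xp i) ∧ xm i < 0 ∧ 0 < xp i)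
    (h0 : 0 ≤ p₀) (hε : p₀ < ε) (hlt : ∀ a ∈ Ioo 0 p₀, ∀ᶠ i in l, a < φ i a)
    (hgt : ∀ b ∈ Ioo p₀ ε, ∀ᶠ i in l, φ i b < b) : Tendsto xp l (𝓝 p₀) := by
  refine tendsto_order.2 ⟨fun a ha => ?_, fun b hb => ?_⟩
  · rcases le_or_gt a 0 with h | h
    · filter_upwards [hφ] with i hi
      exact h.trans_lt hi.2.2
    · filter_upwards [hφ, hlt a ⟨h, ha⟩] with i hi hai
      by_contra! hc
      rcases hc.eq_or_lt with hc | hc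
      · exact hai.ne (hc ▸ hi.1.map_right).symm
      · exact hai.not_gt (hi.1.map_lt_of_right_lt ⟨by linarith, by linarith⟩ hc)
  · have hb' : min b ((p₀ + ε) / 2) ∈ Ioo p₀ ε :=
      ⟨lt_min hb (by linarith), (min_le_right _ _).trans_lt (by linarith)⟩
    filter_upwards [hφ, hgt _ hb'] with i hi hbi
    refine lt_of_lt_of_le ?_ (min_le_left b ((p₀ + ε) / 2))
    by_contra! hc
    rcases hc.eq_or_lt with hc | hc
    · exact hbi.ne (hc ▸ hi.1.map_right)
    · exact hbi.not_gt (hi.1.lt_map (by linarith [hb'.1]) hc)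

theorem tendsto_left_fix {ι : Type*} {l : Filter ι} {n : ℕ} {φ : ι → ℝ → ℝ} {ε m₀ : ℝ}
    {xm xp : ι → ℝ} (hφ : ∀ᶠ i in l, IsSaddleNodeMap n (φ i) ε (xm i) (xp i) ∧ xm i < 0 ∧ 0 < xp i)
    (h0 : m₀ ≤ 0) (hε : -ε < m₀) (hlt : ∀ a ∈ Ioo m₀ 0, ∀ᶠ i in l, a < φ i a)
    (hgt : ∀ b ∈ Ioo (-ε) m₀, ∀ᶠ i in l, φ i b < b) : Tendsto xm l (𝓝 m₀) := by
  refine tendsto_order.2 ⟨fun b hb => ?_, fun a ha => ?_⟩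
  · have hb' : max b ((m₀ + -ε) / 2) ∈ Ioo (-ε) m₀ :=
      ⟨lt_of_lt_of_le (by linarith) (le_max_right _ _), max_lt hb (by linarith)⟩
    filter_upwards [hφ, hgt _ hb'] with i hi hbi
    refine lt_of_le_of_lt (le_max_left b ((m₀ + -ε) / 2)) ?_
    by_contra! hc
    rcases hc.eq_or_lt with hc | hc
    · exact hbi.ne (hc ▸ hi.1.map_left)
    · exact hbi.not_gt (hi.1.lt_map hc (by linarith [hb'.2]))
  · rcases le_or_gt 0 a with h | h
    · filter_upwards [hφ] with i hi
      exact hi.2.1.trans_le h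
    · filter_upwards [hφ, hlt a ⟨ha, h⟩] with i hi hai
      by_contra! hc
      rcases hc.eq_or_lt with hc | hc
      · exact hai.ne (hc ▸ hi.1.map_left).symm
      · exact hai.not_gt (hi.1.map_lt_of_lt_left ⟨by linarith, by linarith⟩ hc)

/-! ### Multipliers at the two fixed points -/

/-- Taylor expansion of the multipliers at the two fixed points in their distance. -/
theorem exists_multiplier_expansion {φ : ℝ → ℝ} (hφ : ContDiff ℝ 3 φ) {m p : ℝ} (hmp : m < p)
    (hm : φ m = m) (hp : φ p = p) :
    ∃ ξ ∈ Ioo m p, ∃ η ∈ Ioo m p,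
      deriv φ m - 1 = -(iteratedDeriv 2 φ m * (p - m) / 2) - iteratedDeriv 3 φ ξ * (p - m) ^ 2 / 6 ∧
      deriv φ p - deriv φ m =
        iteratedDeriv 2 φ m * (p - m) + iteratedDeriv 3 φ η * (p - m) ^ 2 / 2 := by
  have hL : 0 < p - m := sub_pos.2 hmp
  have hu := uniqueDiffOn_Icc hmp
  have hmem : m ∈ Icc m p := left_mem_Icc.2 hmp.le
  obtain ⟨ξ, hξ, h1⟩ := taylor_mean_remainder_lagrange_iteratedDeriv (n := 2) hmp.ne
    (by exact_mod_cast hφ.contDiffOn)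
  have hφ' : ContDiff ℝ 2 (deriv φ) :=
    (contDiff_succ_iff_deriv (n := 2)).1 (by simpa [two_add_one_eq_three] using hφ) |>.2.2
  obtain ⟨η, hη, h2⟩ := taylor_mean_remainder_lagrange_iteratedDeriv (n := 1) hmp.ne
    (by exact_mod_cast hφ'.contDiffOn)
  rw [uIoo_of_lt hmp] at hξ hη
  rw [uIcc_of_le hmp.le] at h1 h2
  have e1 : iteratedDerivWithin 1 φ (Icc m p) m = deriv φ m := by
    rw [iteratedDerivWithin_eq_iteratedDeriv hu (hφ.of_le (by norm_num)).contDiffAt hmem,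
      iteratedDeriv_one]
  have e2 : iteratedDerivWithin 2 φ (Icc m p) m = iteratedDeriv 2 φ m :=
    iteratedDerivWithin_eq_iteratedDeriv hu (hφ.of_le (by norm_num)).contDiffAt hmem
  have e3 : iteratedDerivWithin 1 (deriv φ) (Icc m p) m = iteratedDeriv 2 φ m := by
    rw [iteratedDerivWithin_eq_iteratedDeriv hu (hφ'.of_le (by norm_num)).contDiffAt hmem,
      iteratedDeriv_succ' (n := 1)]
  rw [← iteratedDeriv_succ'] at h2
  simp [taylorWithinEval_succ, e1, e2, e3, Nat.factorial] at h1 h2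
  refine ⟨ξ, hξ, η, hη, ?_, ?_⟩
  · refine mul_right_cancel₀ hL.ne' ?_
    rw [hm, hp] at h1
    linarith
  · linarith

/-- As two nondegenerate fixed points merge, their multipliers tend to `1` in a ratio tending
to `1`, with a second order deviation determined by the third derivative. -/
theorem tendsto_multipliers {ι : Type*} {l : Filter ι} [l.NeBot] {φ : ι → ℝ → ℝ}
    {xm xp : ι → ℝ} {k₂ k₃ : ℝ} (hk : k₂ < 0)
    (hφ : ∀ᶠ i in l, ContDiff ℝ 3 (φ i) ∧ xm i < xp i ∧ φ i (xm i) = xm i ∧ φ i (xp i) = xp i)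
    (hm : Tendsto xm l (𝓝 0)) (hp : Tendsto xp l (𝓝 0))
    (h₂ : Tendsto (fun q : ι × ℝ => iteratedDeriv 2 (φ q.1) q.2) (l ×ˢ 𝓝 0) (𝓝 k₂))
    (h₃ : Tendsto (fun q : ι × ℝ => iteratedDeriv 3 (φ q.1) q.2) (l ×ˢ 𝓝 0) (𝓝 k₃)) :
    Tendsto (fun i => 1 - deriv (φ i) (xp i)) l (𝓝 0) ∧
    Tendsto (fun i => (deriv (φ i) (xm i) - 1) / (1 - deriv (φ i) (xp i))) l (𝓝 1) ∧
    Tendsto (fun i => ((deriv (φ i) (xm i) - 1) / (1 - deriv (φ i) (xp i)) - 1) /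
      (1 - deriv (φ i) (xp i))) l (𝓝 (2 * k₃ / (3 * k₂ ^ 2))) := by
  obtain ⟨ζ, hζ⟩ := Eventually.choice (r := fun i (z : ℝ × ℝ) =>
      xm i < xp i ∧ z.1 ∈ Ioo (xm i) (xp i) ∧ z.2 ∈ Ioo (xm i) (xp i) ∧
      deriv (φ i) (xm i) - 1 = -(iteratedDeriv 2 (φ i) (xm i) * (xp i - xm i) / 2) -
        iteratedDeriv 3 (φ i) z.1 * (xp i - xm i) ^ 2 / 6 ∧
      deriv (φ i) (xp i) - deriv (φ i) (xm i) = iteratedDeriv 2 (φ i) (xm i) * (xp i - xm i) +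
        iteratedDeriv 3 (φ i) z.2 * (xp i - xm i) ^ 2 / 2) (by
    filter_upwards [hφ] with i hi
    obtain ⟨ξ, hξ, η, hη, h1, h2⟩ := exists_multiplier_expansion hi.1 hi.2.1 hi.2.2.1 hi.2.2.2
    exact ⟨(ξ, η), hi.2.1, hξ, hη, h1, h2⟩)
  have hζ₁ : Tendsto (fun i => (ζ i).1) l (𝓝 0) :=
    tendsto_of_tendsto_of_tendsto_of_le_of_le' hm hp
      (hζ.mono fun i hi => hi.2.1.1.le) (hζ.mono fun i hi => hi.2.1.2.le)
  have hζ₂ : Tendsto (fun i => (ζ i).2) l (𝓝 0) :=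
    tendsto_of_tendsto_of_tendsto_of_le_of_le' hm hp
      (hζ.mono fun i hi => hi.2.2.1.1.le) (hζ.mono fun i hi => hi.2.2.1.2.le)
  have hA := h₃.comp (tendsto_id.prodMk hζ₁)
  have hB := h₃.comp (tendsto_id.prodMk hζ₂)
  have hC := h₂.comp (tendsto_id.prodMk hm)
  simp only [Function.comp_def, id_eq] at hA hB hC
  have hL : Tendsto (fun i => xp i - xm i) l (𝓝 0) := by simpa using hp.sub hm
  set A := fun i => iteratedDeriv 3 (φ i) (ζ i).1
  set B := fun i => iteratedDeriv 3 (φ i) (ζ i).2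
  set C := fun i => iteratedDeriv 2 (φ i) (xm i)
  set D := fun i => xp i - xm i
  have ha : Tendsto (fun i => -(C i / 2) - A i * D i / 6) l (𝓝 (-k₂ / 2)) := by
    have := (hC.div_const 2).neg.sub ((hA.mul hL).div_const 6)
    refine this.trans_eq ?_
    ring_nf
  have hb : Tendsto (fun i => -(C i / 2) + A i * D i / 6 - B i * D i / 2) l (𝓝 (-k₂ / 2)) := by
    have := ((hC.div_const 2).neg.add ((hA.mul hL).div_const 6)).sub ((hB.mul hL).div_const 2)
    refine this.trans_eq ?_
    ring_nf
  have hc : Tendsto (fun i => -(A i / 3) + B i / 2) l (𝓝 (k₃ / 6)) := by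
    have := (hA.div_const 3).neg.add (hB.div_const 2)
    refine this.trans_eq ?_
    ring_nf
  have hk' : -k₂ / 2 ≠ 0 := by linarith
  have key : ∀ᶠ i in l, D i ≠ 0 ∧ -(C i / 2) + A i * D i / 6 - B i * D i / 2 ≠ 0 ∧
      deriv (φ i) (xm i) - 1 = D i * (-(C i / 2) - A i * D i / 6) ∧
      1 - deriv (φ i) (xp i) = D i * (-(C i / 2) + A i * D i / 6 - B i * D i / 2) := by
    filter_upwards [hζ, hb.eventually_ne hk'] with i hi hi'
    obtain ⟨h0, -, -, h1, h2⟩ := hi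
    refine ⟨(sub_pos.2 h0).ne', hi', ?_, ?_⟩
    · simp only [A, C, D]; linarith
    · simp only [A, B, C, D]; linarith
  refine ⟨?_, ?_, ?_⟩
  · have := hL.mul hb
    rw [zero_mul] at this
    exact this.congr' (key.mono fun i hi => hi.2.2.2.symm)
  · have := ha.div hb hk'
    rw [div_self hk'] at this
    refine this.congr' (key.mono fun i hi => ?_)
    simp only [Pi.div_apply]
    rw [hi.2.2.1, hi.2.2.2, mul_div_mul_left _ _ hi.1]
  · have := hc.div (hb.pow 2) (pow_ne_zero 2 hk')
    have hlim : k₃ / 6 / (-k₂ / 2) ^ 2 = 2 * k₃ / (3 * k₂ ^ 2) := by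
      have := hk.ne
      field_simp
      ring
    rw [hlim] at this
    refine this.congr' (key.mono fun i hi => ?_)
    obtain ⟨h0, h1, h2, h3⟩ := hi
    simp only [Pi.div_apply]
    rw [h2, h3, mul_div_mul_left _ _ h0, div_sub_one h1, div_div, div_eq_div_iff (by positivity)
      (mul_ne_zero h1 (mul_ne_zero h0 h1))]
    ring

theorem tendsto_rightFix {ι : Type*} {l : Filter ι} {κ β : ι → ℝ} {κ₀ β₀ : ℝ}
    (hκ : Tendsto κ l (𝓝 κ₀)) (hβ : Tendsto β l (𝓝 β₀)) :
    Tendsto (fun i => rightFix (κ i) (β i)) l (𝓝 (rightFix κ₀ β₀)) := by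
  have h1 := half_lt_fixRatio κ₀
  have hρ := (continuous_fixRatio.tendsto κ₀).comp hκ
  refine hβ.mul (((hρ.const_sub 1).add (hρ.pow 2)).div
    ((hρ.const_add 1).mul ((hρ.const_mul 2).sub_const 1)) ?_)
  exact (mul_pos (by linarith) (by linarith)).ne'

theorem tendsto_cubicCoeff {ι : Type*} {l : Filter ι} {κ β : ι → ℝ} {κ₀ c : ℝ} (h0 : 0 < κ₀)
    (hκ : Tendsto κ l (𝓝 κ₀)) (hc : Tendsto (fun i => (κ i - 1) / β i) l (𝓝 c)) :
    Tendsto (fun i => cubicCoeff (κ i) (β i)) l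
      (𝓝 (c * ((1 + fixRatio κ₀) * (2 * fixRatio κ₀ - 1) /
        ((κ₀ + √(κ₀ ^ 2 - κ₀ + 1)) * (1 - fixRatio κ₀ + fixRatio κ₀ ^ 2) ^ 2)))) := by
  have hρ := (continuous_fixRatio.tendsto κ₀).comp hκ
  have h2 := fixRatio_quadratic_pos κ₀
  refine hc.mul (((hρ.const_add 1).mul ((hρ.const_mul 2).sub_const 1)).div
    ((hκ.add ((((hκ.pow 2).sub hκ).add_const 1).sqrt)).mul
      (((hρ.const_sub 1).add (hρ.pow 2)).pow 2)) ?_)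
  positivity

/-! ### The fixed points of a saddle-node family -/

theorem exists_isSaddleNodeMap_family {r : ℕ} (hr : 2 ≤ r) {f : ℝ → ℝ → ℝ}
    (hf : ContDiff ℝ r (Function.uncurry f)) (h00 : f 0 0 = 0)
    (hfx : deriv (fun x => f x 0) 0 = 1) (hfμ : 0 < deriv (fun μ => f 0 μ) 0)
    (hfxx : iteratedDeriv 2 (fun x => f x 0) 0 < 0) :
    ∃ ε > 0, ∃ δ > 0, ∃ xm xp : ℝ → ℝ,
      (∀ μ ∈ Ioo 0 δ, IsSaddleNodeMap r (fun x => f x μ) ε (xm μ) (xp μ) ∧ xm μ < 0 ∧ 0 < xp μ) ∧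
      (∀ x ∈ Icc (-ε) ε, x ≠ 0 → f x 0 < x) := by
  have hf₂ : ContDiff ℝ (0 + 2 : ℕ) (Function.uncurry f) := hf.of_le (by exact_mod_cast hr)
  have hc₁ := (hf₂.of_le (by norm_num)).uncurry_iteratedDeriv (n := 0) 1 |>.continuous
  have hc₂ := hf₂.uncurry_iteratedDeriv 2 |>.continuous
  have hfs : ∀ μ, ContDiff ℝ r (fun x => f x μ) := fun μ =>
    hf.comp (contDiff_id.prodMk contDiff_const)
  have hU : ∀ᶠ q : ℝ × ℝ in 𝓝 (0, 0), 0 < iteratedDeriv 1 (fun x => f x q.2) q.1 ∧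
      iteratedDeriv 2 (fun x => f x q.2) q.1 < 0 := by
    refine (hc₁.continuousAt.eventually_const_lt ?_).and (hc₂.continuousAt.eventually_lt_const ?_)
    · simp [Function.uncurry, hfx]
    · simpa [Function.uncurry] using hfxx
  obtain ⟨ρ, hρ, hball⟩ := Metric.eventually_nhds_iff.1 hU
  have hloc : ∀ x ∈ Icc (-(ρ / 2)) (ρ / 2), ∀ μ, |μ| < ρ →
      0 < deriv (fun x => f x μ) x ∧ iteratedDeriv 2 (fun x => f x μ) x < 0 := by
    intro x hx μ hμ
    have : dist (x, μ) ((0, 0) : ℝ × ℝ) < ρ := by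
      rw [Prod.dist_eq, max_lt_iff]
      simp only [Real.dist_eq, sub_zero]
      exact ⟨(abs_le.2 hx).trans_lt (by linarith), hμ⟩
    simpa using hball this
  have hconc : ∀ μ, |μ| < ρ →
      StrictConcaveOn ℝ (Icc (-(ρ / 2)) (ρ / 2)) (fun x => f x μ) := fun μ hμ =>
    strictConcaveOn_of_deriv2_neg (convex_Icc _ _) (hfs μ).continuous.continuousOn
      fun x hx => by
        rw [← iteratedDeriv_eq_iterate]
        exact (hloc x (interior_subset hx) μ hμ).2
  have hzero : (0 : ℝ) ∈ Icc (-(ρ / 2)) (ρ / 2) := ⟨by linarith, by linarith⟩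
  have hbelow : ∀ x ∈ Icc (-(ρ / 2)) (ρ / 2), x ≠ 0 → f x 0 < x := by
    intro x hx hx0
    have hd : DifferentiableAt ℝ (fun x => f x 0) 0 :=
      (hfs 0).differentiable (by exact_mod_cast (by omega : r ≠ 0)) 0
    have hρ0 : |(0 : ℝ)| < ρ := by simpa
    rcases hx0.lt_or_gt with h | h
    · have := (hconc 0 hρ0).deriv_lt_slope hx hzero h hd
      rw [hfx, slope_def_field, h00, lt_div_iff₀ (by linarith)] at this
      linarith
    · have := (hconc 0 hρ0).slope_lt_deriv hzero hx h hd
      rw [hfx, slope_def_field, h00, div_lt_iff₀ (by linarith)] at this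
      linarith
  have hcμ : ∀ x, Continuous (fun μ => f x μ) := fun x =>
    hf.continuous.comp (continuous_const.prodMk continuous_id)
  have hpos : ∀ᶠ μ in 𝓝[>] 0, 0 < f 0 μ := by
    have h := (hasDerivAt_iff_tendsto_slope_zero.1
      (differentiableAt_of_deriv_ne_zero hfμ.ne').hasDerivAt).mono_left
      (nhdsWithin_mono 0 fun x (hx : 0 < x) => hx.ne')
    filter_upwards [h.eventually_const_lt hfμ, self_mem_nhdsWithin] with μ h1 (h2 : 0 < μ)
    simp only [zero_add, h00, sub_zero, smul_eq_mul] at h1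
    exact (mul_pos_iff_of_pos_left (inv_pos.2 h2)).1 h1
  have hev : ∀ᶠ μ in 𝓝[>] (0 : ℝ), |μ| < ρ ∧ 0 < f 0 μ ∧ f (ρ / 2) μ < ρ / 2 ∧
      f (-(ρ / 2)) μ < -(ρ / 2) := by
    refine .and (.filter_mono nhdsWithin_le_nhds ?_) (hpos.and (.and (.filter_mono
      nhdsWithin_le_nhds ?_) (.filter_mono nhdsWithin_le_nhds ?_)))
    · exact continuous_abs.continuousAt.eventually_lt_const (by simpa)
    · exact (hcμ _).continuousAt.eventually_lt_const
        (hbelow _ ⟨by linarith, le_rfl⟩ (by linarith))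
    · exact (hcμ _).continuousAt.eventually_lt_const
        (hbelow _ ⟨le_rfl, by linarith⟩ (by linarith))
  obtain ⟨δ, hδ, hδev⟩ := mem_nhdsGT_iff_exists_Ioo_subset.1 hev
  have hfix : ∀ μ, ∃ m p, μ ∈ Ioo 0 δ →
      IsSaddleNodeMap r (fun x => f x μ) (ρ / 2) m p ∧ m < 0 ∧ 0 < p := by
    intro μ
    by_cases hμ : μ ∈ Ioo 0 δ
    · obtain ⟨h1, h2, h3, h4⟩ := hδev hμ
      have hcont : Continuous fun x => f x μ - x := (hfs μ).continuous.sub continuous_id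
      obtain ⟨m, hm, hm0⟩ := intermediate_value_Ioo (show -(ρ / 2) ≤ 0 by linarith)
        hcont.continuousOn (show (0 : ℝ) ∈ _ from ⟨by linarith, by linarith⟩)
      obtain ⟨p, hp, hp0⟩ := intermediate_value_Ioo' (show 0 ≤ ρ / 2 by linarith)
        hcont.continuousOn (show (0 : ℝ) ∈ _ from ⟨by linarith, by linarith⟩)
      exact ⟨m, p, fun _ => ⟨⟨hfs μ, fun x hx => (hloc x hx μ h1).1, hconc μ h1, hm.1,
        hm.2.trans hp.1, hp.2, sub_eq_zero.1 hm0, sub_eq_zero.1 hp0⟩, hm.2, hp.1⟩⟩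
    · exact ⟨0, 0, fun h => absurd h hμ⟩
  choose xm xp hx using hfix
  exact ⟨ρ / 2, by linarith, δ, hδ, xm, xp, hx, hbelow⟩

theorem Continuous.tendsto_swap {F : ℝ × ℝ → ℝ} (hF : Continuous F) (x μ : ℝ) :
    Tendsto (fun q : ℝ × ℝ => F (q.2, q.1)) (𝓝[>] μ ×ˢ 𝓝 x) (𝓝 (F (x, μ))) := by
  refine (hF.tendsto (x, μ)).comp ?_
  rw [nhds_prod_eq]
  exact tendsto_snd.prodMk (tendsto_fst.mono_right nhdsWithin_le_nhds)

/-- A saddle-node family has, for small positive parameters, two fixed points whose multipliers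
depend continuously on the parameter and have the asymptotics of `tendsto_multipliers`. -/
theorem exists_multipliers {r : ℕ} (hr : 3 ≤ r) {f : ℝ → ℝ → ℝ}
    (hf : ContDiff ℝ r (Function.uncurry f)) (h00 : f 0 0 = 0)
    (hfx : deriv (fun x => f x 0) 0 = 1) (hfμ : 0 < deriv (fun μ => f 0 μ) 0)
    (hfxx : iteratedDeriv 2 (fun x => f x 0) 0 < 0) :
    ∃ ε > 0, ∃ δ > 0, ∃ xm xp : ℝ → ℝ,
      (∀ μ ∈ Ioo 0 δ, IsSaddleNodeMap r (fun x => f x μ) ε (xm μ) (xp μ)) ∧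
      ContinuousOn (fun μ => deriv (fun x => f x μ) (xm μ)) (Ioo 0 δ) ∧
      ContinuousOn (fun μ => deriv (fun x => f x μ) (xp μ)) (Ioo 0 δ) ∧
      Tendsto (fun μ => 1 - deriv (fun x => f x μ) (xp μ)) (𝓝[>] 0) (𝓝 0) ∧
      Tendsto (fun μ => (deriv (fun x => f x μ) (xm μ) - 1) / (1 - deriv (fun x => f x μ) (xp μ)))
        (𝓝[>] 0) (𝓝 1) ∧
      Tendsto (fun μ => ((deriv (fun x => f x μ) (xm μ) - 1) /
        (1 - deriv (fun x => f x μ) (xp μ)) - 1) / (1 - deriv (fun x => f x μ) (xp μ))) (𝓝[>] 0)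
        (𝓝 (2 * iteratedDeriv 3 (fun x => f x 0) 0 /
          (3 * (iteratedDeriv 2 (fun x => f x 0) 0) ^ 2))) := by
  obtain ⟨ε, hε, δ, hδ, xm, xp, hx, hbelow⟩ :=
    exists_isSaddleNodeMap_family (by omega) hf h00 hfx hfμ hfxx
  have hf₃ : ContDiff ℝ (0 + 3 : ℕ) (Function.uncurry f) :=
    hf.of_le (by exact_mod_cast (by omega : 0 + 3 ≤ r))
  have hc₁ := ((hf₃.of_le (by norm_num)).uncurry_deriv (n := 0)).continuous
  have hc₂ : Continuous fun q : ℝ × ℝ => iteratedDeriv 2 (fun x => f x q.2) q.1 :=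
    ((hf₃.of_le (by norm_num)).uncurry_iteratedDeriv (n := 0) 2).continuous
  have hc₃ : Continuous fun q : ℝ × ℝ => iteratedDeriv 3 (fun x => f x q.2) q.1 :=
    (hf₃.uncurry_iteratedDeriv 3).continuous
  have hcμ : ∀ x, Continuous (fun μ => f x μ) := fun x =>
    hf.continuous.comp (continuous_const.prodMk continuous_id)
  have hpos : ∀ᶠ μ in 𝓝[>] (0 : ℝ), μ ∈ Ioo 0 δ := Ioo_mem_nhdsGT hδ
  have hm0 : Tendsto xm (𝓝[>] 0) (𝓝 0) :=
    tendsto_left_fix (hpos.mono hx) le_rfl (by linarith) (fun a ha => by simp at ha)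
      fun b hb => .filter_mono nhdsWithin_le_nhds <| (hcμ b).continuousAt.eventually_lt_const
        (hbelow b ⟨hb.1.le, by linarith [hb.2]⟩ hb.2.ne)
  have hp0 : Tendsto xp (𝓝[>] 0) (𝓝 0) :=
    tendsto_right_fix (hpos.mono hx) le_rfl hε (fun a ha => by simp at ha)
      fun b hb => .filter_mono nhdsWithin_le_nhds <| (hcμ b).continuousAt.eventually_lt_const
        (hbelow b ⟨by linarith [hb.1], hb.2.le⟩ hb.1.ne')
  have hmc : ContinuousOn xm (Ioo 0 δ) := fun μ hμ =>
    tendsto_left_fix (eventually_mem_nhdsWithin.mono hx) (hx μ hμ).2.1.le (hx μ hμ).1.neg_lt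
      (fun a ha => (hcμ a).continuousWithinAt.eventually_const_lt
        ((hx μ hμ).1.lt_map ha.1 (ha.2.trans (hx μ hμ).2.2)))
      fun b hb => (hcμ b).continuousWithinAt.eventually_lt_const
        ((hx μ hμ).1.map_lt_of_lt_left ⟨hb.1.le, by linarith [hb.2, (hx μ hμ).2.1]⟩ hb.2)
  have hpc : ContinuousOn xp (Ioo 0 δ) := fun μ hμ =>
    tendsto_right_fix (eventually_mem_nhdsWithin.mono hx) (hx μ hμ).2.2.le (hx μ hμ).1.lt_eps
      (fun a ha => (hcμ a).continuousWithinAt.eventually_const_lt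
        ((hx μ hμ).1.lt_map ((hx μ hμ).2.1.trans ha.1) ha.2))
      fun b hb => (hcμ b).continuousWithinAt.eventually_lt_const
        ((hx μ hμ).1.map_lt_of_right_lt ⟨by linarith [hb.1, (hx μ hμ).2.2], hb.2.le⟩ hb.1)
  have h₂ : Tendsto (fun q : ℝ × ℝ => iteratedDeriv 2 (fun x => f x q.1) q.2) (𝓝[>] 0 ×ˢ 𝓝 0)
      (𝓝 (iteratedDeriv 2 (fun x => f x 0) 0)) := hc₂.tendsto_swap 0 0
  have h₃ : Tendsto (fun q : ℝ × ℝ => iteratedDeriv 3 (fun x => f x q.1) q.2) (𝓝[>] 0 ×ˢ 𝓝 0)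
      (𝓝 (iteratedDeriv 3 (fun x => f x 0) 0)) := hc₃.tendsto_swap 0 0
  have hφ : ∀ᶠ μ in 𝓝[>] (0 : ℝ), ContDiff ℝ 3 (fun x => f x μ) ∧ xm μ < xp μ ∧
      f (xm μ) μ = xm μ ∧ f (xp μ) μ = xp μ := by
    filter_upwards [hpos] with μ hμ
    have h := (hx μ hμ).1
    have h3 : ContDiff ℝ (3 : ℕ) (fun x => f x μ) := h.contDiff.of_le (Nat.cast_le.2 hr)
    exact ⟨by exact_mod_cast h3, h.lt, h.map_left, h.map_right⟩
  exact ⟨ε, hε, δ, hδ, xm, xp, fun μ hμ => (hx μ hμ).1,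
    hc₁.comp_continuousOn (hmc.prodMk continuousOn_id),
    hc₁.comp_continuousOn (hpc.prodMk continuousOn_id),
    tendsto_multipliers hfxx hφ hm0 hp0 h₂ h₃⟩

/-- Extended normal form theorem for the saddle-node bifurcation: a `C^r`
family (`r ≥ 4`) satisfying the saddle-node conditions at `(x,μ) = (0,0)` is,
for small `μ > 0`, `C^{r-1}`-conjugate to the extended normal form
`g(y,ν,a) = y + ν - y² + a y³` with `ν = F(μ)`, `a = G(μ)`, on the basins of
each of the two corresponding fixed points (the left, repelling ones via
backward-orbit basins, the right, attracting ones via forward basins). -/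
theorem saddle_node_extended_normal_form (r : ℕ) (hr : 4 ≤ r)
    (f : ℝ → ℝ → ℝ) (hf : ContDiff ℝ r (Function.uncurry f))
    (h00 : f 0 0 = 0)
    (hfx : deriv (fun x => f x 0) 0 = 1)
    (hfμ : 0 < deriv (fun μ => f 0 μ) 0)
    (hfxx : iteratedDeriv 2 (fun x => f x 0) 0 < 0)
    (g : ℝ → ℝ → ℝ → ℝ)
    (hg : g = fun y ν a => y + ν - y ^ 2 + a * y ^ 3) :
    ∃ δ > (0 : ℝ), ∃ N M : Set ℝ,
      IsOpen N ∧ (0 : ℝ) ∈ N ∧ IsOpen M ∧ (0 : ℝ) ∈ M ∧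
      ∃ F G : ℝ → ℝ,
        ContinuousOn F (Set.Ioo 0 δ) ∧ ContinuousOn G (Set.Ioo 0 δ) ∧
        Filter.Tendsto F (nhdsWithin 0 (Set.Ioi 0)) (nhds 0) ∧
        Filter.Tendsto G (nhdsWithin 0 (Set.Ioi 0))
          (nhds (2 * iteratedDeriv 3 (fun x => f x 0) 0 /
            (3 * (iteratedDeriv 2 (fun x => f x 0) 0) ^ 2))) ∧
        ∀ μ ∈ Set.Ioo (0 : ℝ) δ,
          ∃ xm xp : ℝ, xm ∈ N ∧ xp ∈ N ∧ xm < xp ∧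
            f xm μ = xm ∧ f xp μ = xp ∧
            (∀ x ∈ N, f x μ = x → x = xm ∨ x = xp) ∧
          ∃ ym yp : ℝ, ym ∈ M ∧ yp ∈ M ∧ ym < yp ∧
            g ym (F μ) (G μ) = ym ∧ g yp (F μ) (G μ) = yp ∧
            (∀ y ∈ M, g y (F μ) (G μ) = y → y = ym ∨ y = yp) ∧
            CrConjOn (r - 1 : ℕ) (fun x => f x μ) (fun y => g y (F μ) (G μ))
              (bwdBasin (fun x => f x μ) N xm)
              (bwdBasin (fun y => g y (F μ) (G μ)) M ym) xm ym ∧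
            CrConjOn (r - 1 : ℕ) (fun x => f x μ) (fun y => g y (F μ) (G μ))
              (fwdBasin (fun x => f x μ) N xp)
              (fwdBasin (fun y => g y (F μ) (G μ)) M yp) xp yp := by
  subst hg
  obtain ⟨n, rfl⟩ : ∃ n, r = n + 2 := ⟨r - 2, by omega⟩
  obtain ⟨ε, hε, δ, hδ, xm, xp, hx, hmc, hpc, hβ0, hκ1, hκβ⟩ :=
    exists_multipliers (by omega) hf h00 hfx hfμ hfxx
  have hpos : ∀ᶠ μ in 𝓝[>] (0 : ℝ), μ ∈ Ioo 0 δ := Ioo_mem_nhdsGT hδ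
  let β : ℝ → ℝ := fun μ => 1 - deriv (fun x => f x μ) (xp μ)
  let κ : ℝ → ℝ := fun μ => (deriv (fun x => f x μ) (xm μ) - 1) / β μ
  have hβpos : ∀ μ ∈ Ioo 0 δ, 0 < β μ := fun μ hμ => sub_pos.2 (hx μ hμ).deriv_right_lt
  have hκpos : ∀ μ ∈ Ioo 0 δ, 0 < κ μ := fun μ hμ =>
    div_pos (sub_pos.2 (hx μ hμ).lt_deriv_left) (hβpos μ hμ)
  have hβc : ContinuousOn β (Ioo 0 δ) :=
    continuousOn_const.sub (hpc)
  have hκc : ContinuousOn κ (Ioo 0 δ) :=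
    (hmc.sub continuousOn_const).div hβc
      fun μ hμ => (hβpos μ hμ).ne'
  change Tendsto β _ _ at hβ0
  change Tendsto κ _ _ at hκ1
  change Tendsto (fun μ => (κ μ - 1) / β μ) _ _ at hκβ
  have hG0 := tendsto_cubicCoeff one_pos hκ1 hκβ
  norm_num [fixRatio_one] at hG0
  have hY0 := tendsto_rightFix hκ1 hβ0
  rw [rightFix, zero_mul] at hY0
  have hGc : ContinuousOn (fun μ => cubicCoeff (κ μ) (β μ)) (Ioo 0 δ) := fun μ hμ =>
    tendsto_cubicCoeff (hκpos μ hμ) (hκc μ hμ)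
      (((hκc μ hμ).sub_const 1).div (hβc μ hμ) (hβpos μ hμ).ne')
  have hYc : ContinuousOn (fun μ => rightFix (κ μ) (β μ)) (Ioo 0 δ) := fun μ hμ =>
    tendsto_rightFix (hκc μ hμ) (hβc μ hμ)
  set a₀ := 2 * iteratedDeriv 3 (fun x => f x 0) 0 /
    (3 * (iteratedDeriv 2 (fun x => f x 0) 0) ^ 2)
  have hA : 1 ≤ |a₀| + 1 := by linarith [abs_nonneg a₀]
  have hA' : 0 < 1 / (10 * (|a₀| + 1)) := by positivity
  have hev : ∀ᶠ μ in 𝓝[>] (0 : ℝ), μ ∈ Ioo 0 δ ∧ |cubicCoeff (κ μ) (β μ)| < |a₀| + 1 ∧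
      rightFix (κ μ) (β μ) < 1 / (10 * (|a₀| + 1)) ∧
      fixRatio (κ μ) * rightFix (κ μ) (β μ) < 1 / (10 * (|a₀| + 1)) := by
    refine hpos.and ((hG0.abs.eventually_lt_const (by linarith)).and
      ((hY0.eventually_lt_const hA').and (Tendsto.eventually_lt_const (v := 0) hA' ?_)))
    simpa using ((continuous_fixRatio.tendsto 1).comp hκ1).mul hY0
  obtain ⟨δ', hδ', hsub⟩ := mem_nhdsGT_iff_exists_Ioo_subset.1 hev
  have hmono : Ioo 0 δ' ⊆ Ioo 0 δ := fun μ hμ => (hsub hμ).1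
  refine ⟨δ', hδ', Ioo (-ε) ε, Ioo (-(1 / (10 * (|a₀| + 1)))) (1 / (10 * (|a₀| + 1))), isOpen_Ioo,
    ⟨by linarith, hε⟩, isOpen_Ioo, ⟨by linarith, hA'⟩, fun μ => unfoldingParam (κ μ) (β μ),
    fun μ => cubicCoeff (κ μ) (β μ), ?_, hGc.mono hmono, ?_, hG0, fun μ hμ => ?_⟩
  · exact ((hYc.pow 2).sub (hGc.mul (hYc.pow 3))).mono hmono
  · simpa [unfoldingParam] using (hY0.pow 2).sub (hG0.mul (hY0.pow 3))
  obtain ⟨hμδ, h1, h2, h3⟩ := hsub hμ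
  have hs := hx μ hμδ
  have hκ := hκpos μ hμδ
  have hβ := hβpos μ hμδ
  have hYpos : 0 < rightFix (κ μ) (β μ) := rightFix_pos hβ
  have hρpos : 0 < fixRatio (κ μ) := by linarith [half_lt_fixRatio (κ μ)]
  have hYneg := mul_pos hρpos hYpos
  have ht : IsSaddleNodeMap (n + 2)
      (fun y => y + unfoldingParam (κ μ) (β μ) - y ^ 2 + cubicCoeff (κ μ) (β μ) * y ^ 3)
      (1 / (10 * (|a₀| + 1))) (-(fixRatio (κ μ) * rightFix (κ μ) (β μ)))
      (rightFix (κ μ) (β μ)) :=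
    isSaddleNodeMap_cubic hA h1.le (by linarith) (by linarith) h2
      (unfoldingParam_eq_left hκ hβ) rfl
  refine ⟨xm μ, xp μ, ⟨hs.neg_lt, hs.lt.trans hs.lt_eps⟩, ⟨hs.neg_lt.trans hs.lt, hs.lt_eps⟩, hs.lt,
    hs.map_left, hs.map_right, fun x hx h => hs.eq_or_eq_of_map_eq (Ioo_subset_Icc_self hx) h,
    _, _, ⟨ht.neg_lt, ht.lt.trans ht.lt_eps⟩, ⟨ht.neg_lt.trans ht.lt, ht.lt_eps⟩, ht.lt,
    ht.map_left, ht.map_right, fun y hy h => ht.eq_or_eq_of_map_eq (Ioo_subset_Icc_self hy) h,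
    hs.crConjOn_bwdBasin ht ?_, hs.crConjOn_fwdBasin ht ?_⟩
  · rw [(hasDerivAt_cubic _ _ _).deriv, multiplier_left hκ hβ, div_mul_cancel₀ _ hβ.ne']
    ring
  · rw [(hasDerivAt_cubic _ _ _).deriv, multiplier_right hκ hβ]
    simp [β]
end

section
/- For all ℓ, ℓ' ∈ [0,1), the Katsura-Fukuda maps F_ℓ : [0,1] → [0,1] and F_{ℓ'} : [0,1] → [0,1] are C^∞-conjugate: there exists a homeomorphism h : [0,1] → [0,1] such that h and h⁻¹ are infinitely differentiable and h(F_ℓ(x)) = F_{ℓ'}(h(x)) for all x ∈ [0,1]. -/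
open scoped ContDiff

theorem hasDerivAt_integral_pow_mul_comp_mul {f : ℝ → ℝ} (hf : ContDiff ℝ ∞ f) (k : ℕ) (t : ℝ) :
    HasDerivAt (fun t => ∫ s in (0 : ℝ)..1, s ^ k * f (s * t))
      (∫ s in (0 : ℝ)..1, s ^ (k + 1) * deriv f (s * t)) t := by
  have hf' : Continuous (deriv f) := (contDiff_infty_iff_deriv.1 hf).2.continuous
  have hfc : Continuous f := hf.continuous
  obtain ⟨C, hC⟩ := (isCompact_closedBall (0 : ℝ) (|t| + 1)).exists_bound_of_continuousOn
    hf'.continuousOn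
  refine (intervalIntegral.hasDerivAt_integral_of_dominated_loc_of_deriv_le
    (F := fun t s => s ^ k * f (s * t)) (F' := fun t s => s ^ (k + 1) * deriv f (s * t))
    (bound := fun _ => C) (Metric.ball_mem_nhds t one_pos) ?_ ?_ ?_ ?_ ?_ ?_).2
  · exact Filter.Eventually.of_forall fun x => Continuous.aestronglyMeasurable (by fun_prop)
  · exact Continuous.intervalIntegrable (by fun_prop) _ _
  · exact Continuous.aestronglyMeasurable (by fun_prop)
  · refine Filter.Eventually.of_forall fun s hs x hx => ?_
    rw [Set.uIoc_of_le zero_le_one] at hs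
    have hxt : |x| ≤ |t| + 1 := by
      rw [Metric.mem_ball, Real.dist_eq] at hx
      have := abs_sub_abs_le_abs_sub x t
      linarith
    have hmem : s * x ∈ Metric.closedBall (0 : ℝ) (|t| + 1) := by
      rw [mem_closedBall_zero_iff, Real.norm_eq_abs, abs_mul, abs_of_pos hs.1]
      nlinarith [abs_nonneg x, hs.1, hs.2]
    rw [norm_mul, norm_pow, Real.norm_of_nonneg hs.1.le]
    calc s ^ (k + 1) * ‖deriv f (s * x)‖ ≤ 1 * ‖deriv f (s * x)‖ := by
          gcongr
          exact pow_le_one₀ hs.1.le hs.2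
      _ ≤ C := by rw [one_mul]; exact hC _ hmem
  · exact intervalIntegrable_const
  · refine Filter.Eventually.of_forall fun s _ x _ => ?_
    have h1 : HasDerivAt f (deriv f (s * x)) (s * x) :=
      (hf.differentiable (by simp)).differentiableAt.hasDerivAt
    have h2 : HasDerivAt (fun x => s * x) s x := by simpa using (hasDerivAt_id x).const_mul s
    refine ((h1.comp x h2).const_mul (s ^ k)).congr_deriv ?_
    ring

theorem contDiff_integral_pow_mul_comp_mul {f : ℝ → ℝ} (hf : ContDiff ℝ ∞ f) (k : ℕ) :
    ContDiff ℝ ∞ (fun t => ∫ s in (0 : ℝ)..1, s ^ k * f (s * t)) := by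
  refine contDiff_infty.2 fun n => ?_
  induction n generalizing f k with
  | zero =>
    exact contDiff_zero.2 (continuous_iff_continuousAt.2 fun t =>
      (hasDerivAt_integral_pow_mul_comp_mul hf k t).continuousAt)
  | succ n ih =>
    push_cast
    refine contDiff_succ_iff_deriv.2 ⟨fun t =>
      (hasDerivAt_integral_pow_mul_comp_mul hf k t).differentiableAt, by simp, ?_⟩
    rw [funext fun t => (hasDerivAt_integral_pow_mul_comp_mul hf k t).deriv]
    exact ih (contDiff_infty_iff_deriv.1 hf).2 (k + 1)

/-- Hadamard's lemma in one variable. -/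
theorem exists_contDiff_eq_sub_mul {f : ℝ → ℝ} (hf : ContDiff ℝ ∞ f) {a : ℝ} (ha : f a = 0) :
    ∃ g : ℝ → ℝ, ContDiff ℝ ∞ g ∧ g a = deriv f a ∧ ∀ x, f x = (x - a) * g x := by
  set p : ℝ → ℝ := fun t => f (t + a) with hp
  have hpc : ContDiff ℝ ∞ p := hf.comp (by fun_prop)
  have hp' : ContDiff ℝ ∞ (deriv p) := (contDiff_infty_iff_deriv.1 hpc).2
  set q : ℝ → ℝ := fun t => ∫ s in (0 : ℝ)..1, s ^ 0 * deriv p (s * t) with hq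
  have hqc : ContDiff ℝ ∞ q := contDiff_integral_pow_mul_comp_mul hp' 0
  have hgc : ContDiff ℝ ∞ fun x => q (x - a) := hqc.comp (by fun_prop)
  have heq : ∀ x, f x = (x - a) * q (x - a) := by
    intro x
    have hd : ∀ s ∈ Set.uIcc (0 : ℝ) 1,
        HasDerivAt (fun s => p (s * (x - a))) ((x - a) * deriv p (s * (x - a))) s := by
      intro s _
      have h1 : HasDerivAt p (deriv p (s * (x - a))) (s * (x - a)) :=
        (hpc.differentiable (by simp)).differentiableAt.hasDerivAt
      have h2 : HasDerivAt (fun s => s * (x - a)) (x - a) s := by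
        simpa using (hasDerivAt_id s).mul_const (x - a)
      refine (h1.comp s h2).congr_deriv ?_
      ring
    have hcont := hp'.continuous
    have := intervalIntegral.integral_eq_sub_of_hasDerivAt hd
      (Continuous.intervalIntegrable (by fun_prop) _ _)
    rw [intervalIntegral.integral_const_mul] at this
    simp only [hq, pow_zero, one_mul]
    rw [this]
    simp [hp, ha]
  refine ⟨fun x => q (x - a), hgc, ?_, heq⟩
  have h1 : HasDerivAt (fun x => q (x - a)) (deriv (fun x => q (x - a)) a) a :=
    (hgc.differentiable (by simp)).differentiableAt.hasDerivAt
  have h2 := ((hasDerivAt_id a).sub_const a).mul h1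
  have h3 : f = (fun x => id x - a) * fun x => q (x - a) := funext heq
  rw [h3, h2.deriv]
  simp

/-- The quotient of a smooth function by a smooth function with simple zeros, extended to the
zeros of the denominator by the quotient of derivatives. -/
noncomputable def simpleZeroQuotient (u v : ℝ → ℝ) (x : ℝ) : ℝ :=
  if v x = 0 then deriv u x / deriv v x else u x / v x

theorem simpleZeroQuotient_mul {u v : ℝ → ℝ} (huv : ∀ x, v x = 0 → u x = 0) (x : ℝ) :
    simpleZeroQuotient u v x * v x = u x := by
  unfold simpleZeroQuotient
  split_ifs with h
  · rw [h, huv x h, mul_zero]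
  · exact div_mul_cancel₀ _ h

theorem contDiff_simpleZeroQuotient {u v : ℝ → ℝ} (hu : ContDiff ℝ ∞ u) (hv : ContDiff ℝ ∞ v)
    (huv : ∀ x, v x = 0 → u x = 0) (hv' : ∀ x, v x = 0 → deriv v x ≠ 0) :
    ContDiff ℝ ∞ (simpleZeroQuotient u v) := by
  refine contDiff_iff_contDiffAt.2 fun a => ?_
  by_cases h : v a = 0
  · obtain ⟨p, hp, hpa, hup⟩ := exists_contDiff_eq_sub_mul hu (huv a h)
    obtain ⟨q, hq, hqa, hvq⟩ := exists_contDiff_eq_sub_mul hv h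
    have hqa0 : q a ≠ 0 := hqa ▸ hv' a h
    refine (hp.contDiffAt.div hq.contDiffAt hqa0).congr_of_eventuallyEq ?_
    filter_upwards [hq.continuous.continuousAt.eventually_ne hqa0] with x hx
    rcases eq_or_ne x a with rfl | hxa
    · simp [simpleZeroQuotient, h, hpa, hqa]
    · have hxa' : x - a ≠ 0 := sub_ne_zero.2 hxa
      have hvx : v x ≠ 0 := by rw [hvq]; exact mul_ne_zero hxa' hx
      rw [simpleZeroQuotient, if_neg hvx, hup, hvq, mul_div_mul_left _ _ hxa', Pi.div_apply]
  · refine (hu.contDiffAt.div hv.contDiffAt h).congr_of_eventuallyEq ?_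
    filter_upwards [hv.continuous.continuousAt.eventually_ne h] with x hx
    rw [simpleZeroQuotient, if_neg hx, Pi.div_apply]

/-- `f` descends along `θ ↦ sin² θ`. -/
def EvenPiPeriodic (f : ℝ → ℝ) : Prop :=
  (∀ x, f (-x) = f x) ∧ ∀ x, f (x + Real.pi) = f x

theorem EvenPiPeriodic.comp_arcsin_sqrt_sin_sq {f : ℝ → ℝ} (hf : EvenPiPeriodic f) (x : ℝ) :
    f (Real.arcsin √(Real.sin x ^ 2)) = f x := by
  set y := Real.arcsin √(Real.sin x ^ 2) with hy
  have hsin : Real.sin y ^ 2 = Real.sin x ^ 2 := by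
    rw [hy, Real.sin_arcsin, Real.sq_sqrt (sq_nonneg _)]
    · linarith [Real.sqrt_nonneg (Real.sin x ^ 2)]
    · exact Real.sqrt_le_one.2 (Real.sin_sq_le_one x)
  have hcos : Real.cos (2 * y) = Real.cos (2 * x) := by
    rw [Real.cos_two_mul, Real.cos_two_mul, Real.cos_sq', Real.cos_sq', hsin]
  have hper : Function.Periodic f Real.pi := hf.2
  obtain ⟨k, hk | hk⟩ := Real.cos_eq_cos_iff.1 hcos
  · rw [show x = y + k * Real.pi by linarith, hper.int_mul k y]
  · rw [show x = -y + k * Real.pi by linarith, hper.int_mul k (-y), hf.1]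

theorem deriv_sin_two_mul (x : ℝ) :
    deriv (fun x => Real.sin (2 * x)) x = 2 * Real.cos (2 * x) := by
  have h := ((hasDerivAt_id x).const_mul 2).sin
  simp only [id] at h
  rw [h.deriv]
  ring

/-- The derivative of a smooth even `π`-periodic function is `sin (2 θ)` times a function of the
same kind. -/
theorem EvenPiPeriodic.exists_deriv_eq_mul_sin {f : ℝ → ℝ} (hf : EvenPiPeriodic f)
    (hfc : ContDiff ℝ ∞ f) :
    ∃ g, EvenPiPeriodic g ∧ ContDiff ℝ ∞ g ∧ ∀ x, deriv f x = g x * Real.sin (2 * x) := by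
  have hneg : ∀ x, deriv f (-x) = -deriv f x := fun x => by
    have h := deriv_comp_neg f x
    rw [show (fun x => f (-x)) = f from funext hf.1] at h
    linarith
  have hper : ∀ x, deriv f (x + Real.pi) = deriv f x := fun x => by
    have h := deriv_comp_add_const f Real.pi x
    rwa [show (fun x => f (x + Real.pi)) = f from funext hf.2, eq_comm] at h
  have hneg2 : ∀ x, deriv (deriv f) (-x) = deriv (deriv f) x := fun x => by
    have h := deriv_comp_neg (deriv f) x
    rw [show (fun x => deriv f (-x)) = fun x => -deriv f x from funext hneg, deriv.fun_neg] at h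
    linarith
  have hper2 : ∀ x, deriv (deriv f) (x + Real.pi) = deriv (deriv f) x := fun x => by
    have h := deriv_comp_add_const (deriv f) Real.pi x
    rwa [show (fun x => deriv f (x + Real.pi)) = deriv f from funext hper, eq_comm] at h
  have hzero : ∀ x, Real.sin (2 * x) = 0 → deriv f x = 0 := by
    intro x hx
    obtain ⟨k, hk⟩ := Real.sin_eq_zero_iff.1 hx
    have h1 : deriv f x = deriv f (-x) := by
      have hp : Function.Periodic (deriv f) Real.pi := hper
      rw [← hp.int_mul k (-x), hk]
      ring_nf
    linarith [hneg x]
  have hs : ∀ x : ℝ, Real.sin (2 * (x + Real.pi)) = Real.sin (2 * x) := fun x => by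
    rw [mul_add, Real.sin_add_two_pi]
  have hc : ∀ x : ℝ, Real.cos (2 * (x + Real.pi)) = Real.cos (2 * x) := fun x => by
    rw [mul_add, Real.cos_add_two_pi]
  refine ⟨simpleZeroQuotient (deriv f) fun x => Real.sin (2 * x), ⟨fun x => ?_, fun x => ?_⟩,
    contDiff_simpleZeroQuotient (contDiff_infty_iff_deriv.1 hfc).2
      (Real.contDiff_sin.comp (by fun_prop)) hzero ?_, fun x => ?_⟩
  · simp only [simpleZeroQuotient, deriv_sin_two_mul, hneg, hneg2, mul_neg, Real.sin_neg,
      Real.cos_neg, neg_eq_zero, neg_div_neg_eq]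
  · simp only [simpleZeroQuotient, deriv_sin_two_mul, hper, hper2, hs, hc]
  · intro x hx
    rw [deriv_sin_two_mul]
    have := Real.sin_sq_add_cos_sq (2 * x)
    rw [hx] at this
    intro h
    have h0 : Real.cos (2 * x) = 0 := by linarith
    norm_num [h0] at this
  · exact (simpleZeroQuotient_mul hzero x).symm

theorem EvenPiPeriodic.eq_add_integral {f g : ℝ → ℝ} (hg : EvenPiPeriodic g)
    (hgc : ContDiff ℝ ∞ g) (hfc : ContDiff ℝ ∞ f)
    (hfg : ∀ x, deriv f x = g x * Real.sin (2 * x)) {x : ℝ} (hx : x ∈ Set.Icc (0 : ℝ) 1) :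
    f (Real.arcsin √x) = f 0 + ∫ t in (0 : ℝ)..x, g (Real.arcsin √t) := by
  have hG : Continuous fun t => g (Real.arcsin √t) :=
    hgc.continuous.comp (Real.continuous_arcsin.comp Real.continuous_sqrt)
  have hd : ∀ y, HasDerivAt
      (fun y => f y - ∫ t in (0 : ℝ)..(Real.sin y ^ 2), g (Real.arcsin √t)) 0 y := by
    intro y
    have h1 : HasDerivAt f (deriv f y) y :=
      (hfc.differentiable (by simp)).differentiableAt.hasDerivAt
    have h2 : HasDerivAt (fun x => ∫ t in (0 : ℝ)..x, g (Real.arcsin √t))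
        (g (Real.arcsin √(Real.sin y ^ 2))) (Real.sin y ^ 2) :=
      hG.integral_hasStrictDerivAt 0 _ |>.hasDerivAt
    have h3 : HasDerivAt (fun y => Real.sin y ^ 2) (Real.sin (2 * y)) y := by
      refine ((Real.hasDerivAt_sin y).pow 2).congr_deriv ?_
      rw [Real.sin_two_mul]
      push_cast
      ring
    refine (h1.sub (h2.comp y h3)).congr_deriv ?_
    rw [hg.comp_arcsin_sqrt_sin_sq, hfg, sub_self]
  have hconst := is_const_of_deriv_eq_zero (fun y => (hd y).differentiableAt)
    (fun y => (hd y).deriv) (Real.arcsin √x) 0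
  have hsin : Real.sin (Real.arcsin √x) ^ 2 = x := by
    rw [Real.sin_arcsin (by linarith [Real.sqrt_nonneg x]) (Real.sqrt_le_one.2 hx.2),
      Real.sq_sqrt hx.1]
  simp only [hsin, Real.sin_zero, ne_eq, OfNat.ofNat_ne_zero, not_false_eq_true, zero_pow,
    intervalIntegral.integral_same, sub_zero] at hconst
  linarith

/-- A smooth even `π`-periodic function of `θ` is a smooth function of `sin² θ`. -/
theorem EvenPiPeriodic.contDiffOn_comp_arcsin_sqrt {f : ℝ → ℝ} (hf : EvenPiPeriodic f)
    (hfc : ContDiff ℝ ∞ f) :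
    ContDiffOn ℝ ∞ (fun x => f (Real.arcsin √x)) (Set.Icc 0 1) := by
  refine contDiffOn_infty.2 fun n => ?_
  induction n generalizing f with
  | zero =>
    exact contDiffOn_zero.2 (hfc.continuous.comp
      (Real.continuous_arcsin.comp Real.continuous_sqrt)).continuousOn
  | succ n ih =>
    obtain ⟨g, hg, hgc, hfg⟩ := hf.exists_deriv_eq_mul_sin hfc
    have hG : Continuous fun t => g (Real.arcsin √t) :=
      hgc.continuous.comp (Real.continuous_arcsin.comp Real.continuous_sqrt)
    have hd : ∀ x ∈ Set.Icc (0 : ℝ) 1, HasDerivWithinAt (fun x => f (Real.arcsin √x))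
        (g (Real.arcsin √x)) (Set.Icc 0 1) x := fun x hx =>
      (((hG.integral_hasStrictDerivAt 0 x).hasDerivAt.const_add (f 0)).hasDerivWithinAt).congr
        (fun y hy => hg.eq_add_integral hgc hfc hfg hy) (hg.eq_add_integral hgc hfc hfg hx)
    have huniq : UniqueDiffOn ℝ (Set.Icc (0 : ℝ) 1) := uniqueDiffOn_Icc zero_lt_one
    push_cast
    refine (contDiffOn_succ_iff_derivWithin huniq).2
      ⟨fun x hx => (hd x hx).differentiableWithinAt, by simp, ?_⟩
    exact (ih hg hgc).congr fun x hx => (hd x hx).derivWithin (huniq x hx)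

/-- The elliptic integral of the first kind with parameter `m`, as a homeomorphism:
`e θ = ∫₀^θ dt / √(1 - m sin² t)`, and `e.symm` is the Jacobi amplitude. -/
structure IsEllipticIntegral (m : ℝ) (e : ℝ ≃ₜ ℝ) : Prop where
  contDiff : ContDiff ℝ ∞ e
  contDiff_symm : ContDiff ℝ ∞ e.symm
  neg : ∀ x, e (-x) = -e x
  add_pi : ∀ x, e (x + Real.pi) = e x + e Real.pi
  pi_pos : 0 < e Real.pi
  hasDerivAt_symm : ∀ u, HasDerivAt e.symm (√(1 - m * Real.sin (e.symm u) ^ 2)) u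

theorem one_sub_mul_sin_sq_pos {m : ℝ} (hm : m ∈ Set.Ico (0 : ℝ) 1) (x : ℝ) :
    0 < 1 - m * Real.sin x ^ 2 := by
  nlinarith [hm.1, hm.2, Real.sin_sq_le_one x, sq_nonneg (Real.sin x)]

theorem exists_isEllipticIntegral {m : ℝ} (hm : m ∈ Set.Ico (0 : ℝ) 1) :
    ∃ e : ℝ ≃ₜ ℝ, IsEllipticIntegral m e := by
  have hpos := one_sub_mul_sin_sq_pos hm
  set w : ℝ → ℝ := fun t => (√(1 - m * Real.sin t ^ 2))⁻¹ with hw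
  have hspos : ∀ x, 0 < √(1 - m * Real.sin x ^ 2) := fun x => Real.sqrt_pos.2 (hpos x)
  have hwpos : ∀ x, 0 < w x := fun x => inv_pos.2 (hspos x)
  have hw1 : ∀ x, 1 ≤ w x := fun x => by
    refine (one_le_inv₀ (hspos x)).2 (Real.sqrt_le_one.2 ?_)
    nlinarith [hm.1, sq_nonneg (Real.sin x)]
  have hwc : ContDiff ℝ ∞ w :=
    ContDiff.inv (ContDiff.sqrt (by fun_prop) fun x => (hpos x).ne') fun x => (hspos x).ne'
  have hwcont : Continuous w := hwc.continuous
  set E : ℝ → ℝ := fun x => ∫ t in (0 : ℝ)..x, w t with hE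
  have hd : ∀ x, HasDerivAt E (w x) x := fun x =>
    (hwcont.integral_hasStrictDerivAt 0 x).hasDerivAt
  have hE0 : E 0 = 0 := by simp [hE]
  have hcont : Continuous E := continuous_iff_continuousAt.2 fun x => (hd x).continuousAt
  have hEc : ContDiff ℝ ∞ E := by
    refine contDiff_infty_iff_deriv.2 ⟨fun x => (hd x).differentiableAt, ?_⟩
    rwa [show deriv E = w from funext fun x => (hd x).deriv]
  have hmono : StrictMono E := strictMono_of_deriv_pos fun x => by
    rw [(hd x).deriv]; exact hwpos x
  have hsub : Monotone fun x => E x - x :=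
    monotone_of_deriv_nonneg (fun x => ((hd x).sub (hasDerivAt_id x)).differentiableAt) fun x =>
      ((hd x).sub (hasDerivAt_id x)).deriv.symm ▸ sub_nonneg.2 (hw1 x)
  have hsurj : Function.Surjective E := by
    refine hcont.surjective ?_ ?_
    · refine Filter.tendsto_atTop_mono' _ ?_ Filter.tendsto_id
      filter_upwards [Filter.eventually_ge_atTop 0] with x hx
      have := hsub hx
      simp only [hE0, id] at this ⊢
      linarith
    · refine Filter.tendsto_atBot_mono' _ ?_ Filter.tendsto_id
      filter_upwards [Filter.eventually_le_atBot 0] with x hx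
      have := hsub hx
      simp only [hE0, id] at this ⊢
      linarith
  have hneg : ∀ x, E (-x) = -E x := fun x => by
    have hh : ∀ x, HasDerivAt (fun x => E (-x) + E x) 0 x := fun x => by
      refine (((hd (-x)).scomp x (hasDerivAt_neg x)).add (hd x)).congr_deriv ?_
      simp [hw]
    have h := is_const_of_deriv_eq_zero (fun x => (hh x).differentiableAt)
      (fun x => (hh x).deriv) x 0
    simp only [neg_zero, hE0] at h
    linarith
  have hadd : ∀ x, E (x + Real.pi) = E x + E Real.pi := fun x => by
    have hh : ∀ x, HasDerivAt (fun x => E (x + Real.pi) - E x) 0 x := fun x => by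
      refine (((hd (x + Real.pi)).comp_add_const x Real.pi).sub (hd x)).congr_deriv ?_
      simp [hw]
    have h := is_const_of_deriv_eq_zero (fun x => (hh x).differentiableAt)
      (fun x => (hh x).deriv) x 0
    simp only [zero_add, hE0] at h
    linarith
  set e : ℝ ≃ₜ ℝ := (hmono.orderIsoOfSurjective E hsurj).toHomeomorph with he
  have heE : ∀ x, e x = E x := fun x => rfl
  have hde : ∀ x, HasDerivAt e (w x) x := hd
  refine ⟨e, hEc, e.contDiff_symm_deriv (fun x => (hwpos x).ne') hde hEc, hneg, hadd, ?_, ?_⟩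
  · rw [heE, ← hE0]
    exact hmono Real.pi_pos
  · intro u
    have h := HasDerivAt.of_local_left_inverse e.symm.continuous.continuousAt (hde (e.symm u))
      (hwpos _).ne' (Filter.Eventually.of_forall fun y => e.apply_symm_apply y)
    simpa [hw] using h

namespace IsEllipticIntegral

variable {m : ℝ} {e : ℝ ≃ₜ ℝ}

theorem symm_neg (h : IsEllipticIntegral m e) (u : ℝ) : e.symm (-u) = -e.symm u := by
  apply e.injective
  rw [h.neg, e.apply_symm_apply, e.apply_symm_apply]

theorem symm_add (h : IsEllipticIntegral m e) (u : ℝ) :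
    e.symm (u + e Real.pi) = e.symm u + Real.pi := by
  apply e.injective
  rw [h.add_pi, e.apply_symm_apply, e.apply_symm_apply]

theorem symm_zero (h : IsEllipticIntegral m e) : e.symm 0 = 0 := by
  have := h.symm_neg 0
  rw [neg_zero] at this
  linarith

end IsEllipticIntegral

/-- A solution of a scalar homogeneous linear differential equation vanishing at `0` is zero. -/
theorem eq_zero_of_hasDerivAt_mul {a p : ℝ → ℝ} (ha : Continuous a)
    (hp : ∀ x, HasDerivAt p (a x * p x) x) (h0 : p 0 = 0) (x : ℝ) : p x = 0 := by
  have hd : ∀ x, HasDerivAt (fun x => p x * Real.exp (-∫ t in (0 : ℝ)..x, a t)) 0 x := fun x => by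
    refine ((hp x).mul (ha.integral_hasStrictDerivAt 0 x).hasDerivAt.neg.exp).congr_deriv ?_
    ring
  have h := is_const_of_deriv_eq_zero (fun x => (hd x).differentiableAt)
    (fun x => (hd x).deriv) x 0
  simpa [h0, Real.exp_ne_zero] using h

/-- The duplication formula `sn² (2 u) = F_m (sn² u)`. -/
theorem IsEllipticIntegral.sin_symm_two_mul_sq {m : ℝ} {e : ℝ ≃ₜ ℝ}
    (hm : m ∈ Set.Ico (0 : ℝ) 1) (h : IsEllipticIntegral m e) (u : ℝ) :
    Real.sin (e.symm (2 * u)) ^ 2 =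
      4 * Real.sin (e.symm u) ^ 2 * (1 - Real.sin (e.symm u) ^ 2) *
        (1 - m * Real.sin (e.symm u) ^ 2) / (1 - m * (Real.sin (e.symm u) ^ 2) ^ 2) ^ 2 := by
  set s : ℝ → ℝ := fun u => Real.sin (e.symm u) with hs
  set c : ℝ → ℝ := fun u => Real.cos (e.symm u) with hc
  set d : ℝ → ℝ := fun u => √(1 - m * Real.sin (e.symm u) ^ 2) with hd
  have hpos : ∀ u, 0 < 1 - m * s u ^ 2 := fun u => one_sub_mul_sin_sq_pos hm _
  have hdpos : ∀ u, 0 < d u := fun u => Real.sqrt_pos.2 (hpos u)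
  have hc2 : ∀ u, c u ^ 2 = 1 - s u ^ 2 := fun u => Real.cos_sq' _
  have hd2 : ∀ u, d u ^ 2 = 1 - m * s u ^ 2 := fun u => Real.sq_sqrt (hpos u).le
  have hs' : ∀ u, HasDerivAt s (c u * d u) u := fun u => (h.hasDerivAt_symm u).sin
  have hc' : ∀ u, HasDerivAt c (-s u * d u) u := fun u => (h.hasDerivAt_symm u).cos
  have hd' : ∀ u, HasDerivAt d (-m * s u * c u) u := fun u => by
    refine (((((hs' u).pow 2).const_mul m).const_sub 1).sqrt (hpos u).ne').congr_deriv ?_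
    change -(m * (((2 : ℕ) : ℝ) * s u ^ (2 - 1) * (c u * d u))) / (2 * d u) = _
    rw [div_eq_iff (mul_ne_zero two_ne_zero (hdpos u).ne')]
    push_cast
    ring
  have hs1 : ∀ u, s u ^ 2 ≤ 1 := fun u => Real.sin_sq_le_one _
  have hN : ∀ u, 0 < 1 - m * s u ^ 4 := fun u => by
    nlinarith [hm.1, hm.2, hs1 u, sq_nonneg (s u), mul_nonneg hm.1 (sq_nonneg (s u))]
  have hD : ∀ u, 0 < d u ^ 2 - m * s u ^ 2 * c u ^ 2 := fun u => by
    rw [hd2, hc2]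
    have : 0 < (1 - m * s u ^ 2) ^ 2 := pow_pos (hpos u) 2
    have : 0 ≤ m * (1 - m) * s u ^ 4 :=
      mul_nonneg (mul_nonneg hm.1 (by linarith [hm.2])) (by positivity)
    linarith
  have hscont : Continuous s := continuous_iff_continuousAt.2 fun u => (hs' u).continuousAt
  have hccont : Continuous c := continuous_iff_continuousAt.2 fun u => (hc' u).continuousAt
  have hdcont : Continuous d := continuous_iff_continuousAt.2 fun u => (hd' u).continuousAt
  set S : ℝ → ℝ := fun u => 2 * s u * c u * d u / (1 - m * s u ^ 4) with hS
  set C : ℝ → ℝ := fun u => (c u ^ 2 - s u ^ 2 * d u ^ 2) / (1 - m * s u ^ 4) with hC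
  set D : ℝ → ℝ := fun u => (d u ^ 2 - m * s u ^ 2 * c u ^ 2) / (1 - m * s u ^ 4) with hDd
  have hNd : ∀ u, HasDerivAt (fun u => 1 - m * s u ^ 4) (-(4 * m * s u ^ 3 * (c u * d u))) u :=
    fun u => by
      refine ((((hs' u).pow 4).const_mul m).const_sub 1).congr_deriv ?_
      push_cast
      ring
  have hSd : ∀ u, HasDerivAt S (2 * (C u * D u)) u := fun u => by
    refine (((((hs' u).const_mul 2).mul (hc' u)).mul (hd' u)).div (hNd u)
      (hN u).ne').congr_deriv ?_
    simp only [hC, hDd, Pi.mul_apply]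
    rw [div_mul_div_comm, ← sq, ← mul_div_assoc]
    congr 1
    trans 2 * (c u ^ 2 * d u ^ 2 - s u ^ 2 * d u ^ 2 - m * s u ^ 2 * c u ^ 2) *
      (1 - m * s u ^ 4) + 8 * m * s u ^ 4 * c u ^ 2 * d u ^ 2
    · ring
    · rw [hc2, hd2]
      ring
  have hCd : ∀ u, HasDerivAt C (-(2 * (S u * D u))) u := fun u => by
    refine ((((hc' u).pow 2).sub (((hs' u).pow 2).mul ((hd' u).pow 2))).div (hNd u)
      (hN u).ne').congr_deriv ?_
    simp only [hS, hDd, Pi.mul_apply, Pi.pow_apply, Pi.sub_apply]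
    rw [div_mul_div_comm, ← sq, ← mul_div_assoc, ← neg_div]
    congr 1
    trans s u * c u * d u * ((-2 - 2 * d u ^ 2 + 2 * m * s u ^ 2) * (1 - m * s u ^ 4) +
      4 * m * s u ^ 2 * (c u ^ 2 - s u ^ 2 * d u ^ 2))
    · push_cast
      ring
    · trans s u * c u * d u * (-4 * (d u ^ 2 - m * s u ^ 2 * c u ^ 2))
      · rw [hc2, hd2]
        ring
      · ring
  have hS2 : ∀ u, S u ^ 2 =
      4 * s u ^ 2 * (1 - s u ^ 2) * (1 - m * s u ^ 2) / (1 - m * s u ^ 4) ^ 2 := fun u => by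
    rw [← hc2, ← hd2]
    simp only [hS]
    rw [div_pow]
    congr 1
    ring
  have hSC : ∀ u, S u ^ 2 + C u ^ 2 = 1 := fun u => by
    rw [hS2]
    simp only [hC]
    rw [hc2, hd2, div_pow, ← add_div, div_eq_one_iff_eq (pow_pos (hN u) 2).ne']
    ring
  have hDS : ∀ u, D u ^ 2 = 1 - m * S u ^ 2 := fun u => by
    rw [hS2]
    simp only [hDd]
    rw [hc2, hd2, div_pow, ← mul_div_assoc, eq_sub_iff_add_eq, ← add_div,
      div_eq_one_iff_eq (pow_pos (hN u) 2).ne']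
    ring
  have hDpos : ∀ u, 0 < D u := fun u => div_pos (hD u) (hN u)
  have hScont : Continuous S := continuous_iff_continuousAt.2 fun u => (hSd u).continuousAt
  have hCcont : Continuous C := continuous_iff_continuousAt.2 fun u => (hCd u).continuousAt
  have hDcont : Continuous D := by
    refine Continuous.div (by fun_prop) (by fun_prop) fun u => (hN u).ne'
  have htwo : ∀ u : ℝ, HasDerivAt (fun u : ℝ => 2 * u) 2 u := fun u => by
    simpa using (hasDerivAt_id u).const_mul 2
  have hsum : ∀ u, D u + d (2 * u) ≠ 0 := fun u => (add_pos (hDpos u) (hdpos _)).ne'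
  have hP := eq_zero_of_hasDerivAt_mul
    (p := fun u => S u * c (2 * u) - C u * s (2 * u))
    (a := fun u => 2 * (-m * (S u * c (2 * u) + C u * s (2 * u)) / (D u + d (2 * u))) *
      (S u * s (2 * u) + C u * c (2 * u))) ?_ ?_ ?_ u
  · have hSs : S u ^ 2 = s (2 * u) ^ 2 := by
      have e1 := hSC u
      have e2 := hc2 (2 * u)
      linear_combination (S u * c (2 * u) + C u * s (2 * u)) * hP + s (2 * u) ^ 2 * e1 -
        S u ^ 2 * e2
    change s (2 * u) ^ 2 = 4 * s u ^ 2 * (1 - s u ^ 2) * (1 - m * s u ^ 2) /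
      (1 - m * (s u ^ 2) ^ 2) ^ 2
    rw [← hSs, hS2, ← pow_mul]
  · refine Continuous.mul (Continuous.mul continuous_const
      (Continuous.div (by fun_prop) (by fun_prop) hsum)) (by fun_prop)
  · intro u
    refine (((hSd u).mul ((hc' (2 * u)).scomp u (htwo u))).sub
      ((hCd u).mul ((hs' (2 * u)).scomp u (htwo u)))).congr_deriv ?_
    have hne := hsum u
    have e1 := hSC u
    have e2 := hc2 (2 * u)
    have e3 := hDS u
    have e4 := hd2 (2 * u)
    have key : -m * (S u * c (2 * u) + C u * s (2 * u)) / (D u + d (2 * u)) *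
        (S u * c (2 * u) - C u * s (2 * u)) = D u - d (2 * u) := by
      field_simp
      linear_combination (-m * S u ^ 2) * e2 + m * s (2 * u) ^ 2 * e1 - e3 + e4
    simp only [Function.comp, smul_eq_mul]
    linear_combination -2 * (S u * s (2 * u) + C u * c (2 * u)) * key
  · simp [hS, hs, hC, h.symm_zero]

/-- Rescaling the elliptic integral with parameter `m` to the one with parameter `m'`, as a
self-map of the space of angles. -/
noncomputable def angleConjugacy (e e' : ℝ ≃ₜ ℝ) (x : ℝ) : ℝ :=
  e'.symm (e' Real.pi / e Real.pi * e x)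

/-- The map induced by `angleConjugacy` under `x = sin² θ`. -/
noncomputable def katsuraFukudaConjugacy (e e' : ℝ ≃ₜ ℝ) (x : ℝ) : ℝ :=
  Real.sin (angleConjugacy e e' (Real.arcsin √x)) ^ 2

theorem katsuraFukudaConjugacy_mem_Icc (e e' : ℝ ≃ₜ ℝ) (x : ℝ) :
    katsuraFukudaConjugacy e e' x ∈ Set.Icc (0 : ℝ) 1 :=
  ⟨sq_nonneg _, Real.sin_sq_le_one _⟩

section

variable {m m' : ℝ} {e e' : ℝ ≃ₜ ℝ}

theorem evenPiPeriodic_sin_sq_angleConjugacy (h : IsEllipticIntegral m e)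
    (h' : IsEllipticIntegral m' e') :
    EvenPiPeriodic fun x => Real.sin (angleConjugacy e e' x) ^ 2 := by
  refine ⟨fun x => ?_, fun x => ?_⟩
  · simp [angleConjugacy, h.neg, h'.symm_neg]
  · simp only [angleConjugacy]
    rw [h.add_pi, mul_add, div_mul_cancel₀ _ h.pi_pos.ne', h'.symm_add, Real.sin_add_pi, neg_sq]

theorem katsuraFukudaConjugacy_sin_sq (h : IsEllipticIntegral m e)
    (h' : IsEllipticIntegral m' e') (x : ℝ) :
    katsuraFukudaConjugacy e e' (Real.sin x ^ 2) = Real.sin (angleConjugacy e e' x) ^ 2 :=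
  (evenPiPeriodic_sin_sq_angleConjugacy h h').comp_arcsin_sqrt_sin_sq x

theorem contDiffOn_katsuraFukudaConjugacy (h : IsEllipticIntegral m e)
    (h' : IsEllipticIntegral m' e') :
    ContDiffOn ℝ ∞ (katsuraFukudaConjugacy e e') (Set.Icc 0 1) :=
  (evenPiPeriodic_sin_sq_angleConjugacy h h').contDiffOn_comp_arcsin_sqrt
    ((Real.contDiff_sin.comp
      (h'.contDiff_symm.comp (contDiff_const.mul h.contDiff))).pow 2)

theorem exists_sin_sq_eq {x : ℝ} (hx : x ∈ Set.Icc (0 : ℝ) 1) : ∃ θ, Real.sin θ ^ 2 = x :=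
  ⟨Real.arcsin √x, by
    rw [Real.sin_arcsin (by linarith [Real.sqrt_nonneg x]) (Real.sqrt_le_one.2 hx.2),
      Real.sq_sqrt hx.1]⟩

theorem katsuraFukudaConjugacy_leftInvOn (h : IsEllipticIntegral m e)
    (h' : IsEllipticIntegral m' e') :
    Set.LeftInvOn (katsuraFukudaConjugacy e' e) (katsuraFukudaConjugacy e e')
      (Set.Icc 0 1) := by
  intro x hx
  obtain ⟨θ, rfl⟩ := exists_sin_sq_eq hx
  rw [katsuraFukudaConjugacy_sin_sq h h', katsuraFukudaConjugacy_sin_sq h' h]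
  have h1 := h.pi_pos.ne'
  have h2 := h'.pi_pos.ne'
  have : e Real.pi / e' Real.pi * (e' Real.pi / e Real.pi * e θ) = e θ := by field_simp
  simp only [angleConjugacy, Homeomorph.apply_symm_apply, this, Homeomorph.symm_apply_apply]

theorem katsuraFukudaConjugacy_semiconj (hm : m ∈ Set.Ico (0 : ℝ) 1)
    (hm' : m' ∈ Set.Ico (0 : ℝ) 1) (h : IsEllipticIntegral m e) (h' : IsEllipticIntegral m' e')
    {x : ℝ} (hx : x ∈ Set.Icc (0 : ℝ) 1) :
    katsuraFukudaConjugacy e e' (4 * x * (1 - x) * (1 - m * x) / (1 - m * x ^ 2) ^ 2) =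
      4 * katsuraFukudaConjugacy e e' x * (1 - katsuraFukudaConjugacy e e' x) *
        (1 - m' * katsuraFukudaConjugacy e e' x) /
        (1 - m' * katsuraFukudaConjugacy e e' x ^ 2) ^ 2 := by
  obtain ⟨θ, rfl⟩ := exists_sin_sq_eq hx
  have hdup := h.sin_symm_two_mul_sq hm (e θ)
  rw [e.symm_apply_apply] at hdup
  rw [← hdup, katsuraFukudaConjugacy_sin_sq h h', katsuraFukudaConjugacy_sin_sq h h']
  simp only [angleConjugacy, Homeomorph.apply_symm_apply]
  rw [mul_left_comm]
  exact h'.sin_symm_two_mul_sq hm' _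

end

/-- Any two Katsura-Fukuda maps `F_ℓ`, `F_ℓ'` (`ℓ, ℓ' ∈ [0,1)`) of `[0,1]` are
`C^∞`-conjugate: there is a homeomorphism `h` of `[0,1]`, infinitely
differentiable with infinitely differentiable inverse, with
`h ∘ F_ℓ = F_ℓ' ∘ h` on `[0,1]`. -/
theorem katsura_fukuda_smooth_conjugacy (ℓ ℓ' : ℝ)
    (hℓ : ℓ ∈ Set.Ico (0 : ℝ) 1) (hℓ' : ℓ' ∈ Set.Ico (0 : ℝ) 1)
    (F : ℝ → ℝ → ℝ)
    (hF : F = fun m x => 4 * x * (1 - x) * (1 - m * x) / (1 - m * x ^ 2) ^ 2) :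
    ∃ h h' : ℝ → ℝ, Set.BijOn h (Set.Icc 0 1) (Set.Icc 0 1) ∧
      ContinuousOn h (Set.Icc 0 1) ∧ ContinuousOn h' (Set.Icc 0 1) ∧
      ContDiffOn ℝ (⊤ : ℕ∞) h (Set.Icc 0 1) ∧
      ContDiffOn ℝ (⊤ : ℕ∞) h' (Set.Icc 0 1) ∧
      (∀ x ∈ Set.Icc (0 : ℝ) 1, h' (h x) = x) ∧
      (∀ y ∈ Set.Icc (0 : ℝ) 1, h (h' y) = y) ∧
      ∀ x ∈ Set.Icc (0 : ℝ) 1, h (F ℓ x) = F ℓ' (h x) := by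
  obtain ⟨e, he⟩ := exists_isEllipticIntegral hℓ
  obtain ⟨e', he'⟩ := exists_isEllipticIntegral hℓ'
  have hsmooth := contDiffOn_katsuraFukudaConjugacy he he'
  have hsmooth' := contDiffOn_katsuraFukudaConjugacy he' he
  have hleft := katsuraFukudaConjugacy_leftInvOn he he'
  have hright := katsuraFukudaConjugacy_leftInvOn he' he
  refine ⟨katsuraFukudaConjugacy e e', katsuraFukudaConjugacy e' e,
    Set.InvOn.bijOn ⟨hleft, hright⟩ (fun x _ => katsuraFukudaConjugacy_mem_Icc _ _ x)
      (fun x _ => katsuraFukudaConjugacy_mem_Icc _ _ x),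
    hsmooth.continuousOn, hsmooth'.continuousOn, hsmooth, hsmooth', hleft, hright, ?_⟩
  intro x hx
  subst hF
  exact katsuraFukudaConjugacy_semiconj hℓ hℓ' he he' hx
end
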